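/- arXiv:1009.2029 — 8 statements merged into one kernel-verified Lean document; each statement's English description precedes it below -/
import Mathlib

section
/- For every N ≥ 1 and every λ ∈ GT_{N+1}, one has ∏_{1≤i<j≤N+1}(λ_i−i−λ_j+j) = N! · Σ_{ν ∈ GT_N, ν ≺ λ} ∏_{1≤i<j≤N}(ν_i−i−ν_j+j). Equivalently, the link is a stochastic matrix: Σ_{ν∈GT_N} Λ^{N+1}_N(λ,ν) = 1 for every λ ∈ GT_{N+1}. -/
/-- A signature of length `N`: a nonincreasing `N`-tuple of integers. -/
def Sig (N : ℕ) : Type := {f : Fin N → ℤ // ∀ i j : Fin N, i ≤ j → f j ≤ f i}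

/-- Interlacing `ν ≺ λ` between a signature of length `N` and one of length `N+1`. -/
def Interlace {N : ℕ} (ν : Sig N) (lam : Sig (N + 1)) : Prop :=
  ∀ i : Fin N, lam.1 i.succ ≤ ν.1 i ∧ ν.1 i ≤ lam.1 i.castSucc

instance {N : ℕ} (ν : Sig N) (lam : Sig (N + 1)) : Decidable (Interlace ν lam) := by
  unfold Interlace; infer_instance

/-- `∏_{i<j} (f i - i - f j + j)` (the Vandermonde-type product in shifted coordinates). -/
def vprod {N : ℕ} (f : Fin N → ℤ) : ℤ :=
  ∏ i : Fin N, ∏ j : Fin N,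
    if i < j then (f i - (i : ℕ) - f j + (j : ℕ)) else 1

/-- The link (cotransition probability) `Λ^{N+1}_N(λ, ν)`. -/
noncomputable def link {N : ℕ} (lam : Sig (N + 1)) (ν : Sig N) : ℝ :=
  if Interlace ν lam then (Nat.factorial N : ℝ) * (vprod ν.1 : ℝ) / (vprod lam.1 : ℝ) else 0

theorem eval_descPochhammer_add_one_sub (n : ℕ) (x : ℤ) :
    (descPochhammer ℤ (n + 1)).eval (x + 1) - (descPochhammer ℤ (n + 1)).eval x =
      (n + 1) * (descPochhammer ℤ n).eval x := by
  have h₁ : (descPochhammer ℤ (n + 1)).eval (x + 1) = (x + 1) * (descPochhammer ℤ n).eval x := by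
    simp [descPochhammer_succ_left]
  have h₂ : (descPochhammer ℤ (n + 1)).eval x = (descPochhammer ℤ n).eval x * (x - n) := by
    simp [descPochhammer_succ_right]
  rw [h₁, h₂]
  ring

theorem sum_Icc_eval_descPochhammer (n : ℕ) (c : ℤ) {a b : ℤ} (h : b ≤ a) :
    ((n : ℤ) + 1) * ∑ k ∈ Finset.Icc b a, (descPochhammer ℤ n).eval (c - k) =
      (descPochhammer ℤ (n + 1)).eval (c + 1 - b) - (descPochhammer ℤ (n + 1)).eval (c - a) := by
  induction a, h using Int.leInduction with
  | base =>
    rw [Finset.Icc_self, Finset.sum_singleton, ← eval_descPochhammer_add_one_sub]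
    ring_nf
  | succ a h ih =>
    rw [← Finset.insert_Icc_right_eq_Icc_add_one (by lia), Finset.sum_insert (by simp), mul_add, ih,
      ← eval_descPochhammer_add_one_sub]
    ring_nf

theorem vprod_eq_det_vandermonde {N : ℕ} (f : Fin N → ℤ) :
    vprod f = (Matrix.vandermonde fun i => ((i : ℕ) : ℤ) - f i).det := by
  rw [Matrix.det_vandermonde, vprod]
  refine Finset.prod_congr rfl fun i _ => ?_
  rw [← Finset.prod_filter]
  refine Finset.prod_congr (by ext; simp) fun j _ => by ring

theorem vprod_eq_det_descPochhammer {N : ℕ} (f : Fin N → ℤ) :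
    vprod f = (Matrix.of fun i j : Fin N =>
      (descPochhammer ℤ (j : ℕ)).eval (((i : ℕ) : ℤ) - f i)).det := by
  rw [vprod_eq_det_vandermonde]
  exact Matrix.det_eval_matrixOfPolynomials_eq_det_vandermonde _
    (fun j : Fin N => descPochhammer ℤ (j : ℕ)) (fun j => descPochhammer_natDegree ℤ j)
    (fun j => monic_descPochhammer ℤ j)

/-- Subtracting consecutive rows reduces the size of the determinant by one. -/
theorem vprod_eq_det_sub {N : ℕ} (f : Fin (N + 1) → ℤ) :
    vprod f = (Matrix.of fun i j : Fin N =>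
      (descPochhammer ℤ ((j : ℕ) + 1)).eval (((i : ℕ) : ℤ) + 1 - f i.succ) -
        (descPochhammer ℤ ((j : ℕ) + 1)).eval (((i : ℕ) : ℤ) - f i.castSucc)).det := by
  let A : Matrix (Fin (N + 1)) (Fin (N + 1)) ℤ := Matrix.of fun i j =>
    (descPochhammer ℤ (j : ℕ)).eval (((i : ℕ) : ℤ) - f i)
  let B : Matrix (Fin (N + 1)) (Fin (N + 1)) ℤ := Matrix.of fun i j =>
    Fin.cases (A 0 j) (fun i => A i.succ j - A i.castSucc j) i
  have hAB : A.det = B.det :=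
    Matrix.det_eq_of_forall_row_eq_smul_add_pred (fun _ => 1) (fun j => by simp [B])
      (fun i j => by simp [B])
  rw [vprod_eq_det_descPochhammer]
  change A.det = _
  rw [hAB, Matrix.det_succ_column_zero, Fin.sum_univ_succ,
    Finset.sum_eq_zero fun i _ => by simp [A, B]]
  simp only [A, B, Matrix.of_apply, Fin.cases_zero, Fin.val_zero, descPochhammer_zero,
    Polynomial.eval_one, pow_zero, one_mul, add_zero]
  congr 1

theorem vprod_eq_factorial_mul_sum_piFinset {N : ℕ} (lam : Sig (N + 1)) :
    vprod lam.1 = (Nat.factorial N : ℤ) *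
      ∑ ν ∈ Fintype.piFinset fun i : Fin N => Finset.Icc (lam.1 i.succ) (lam.1 i.castSucc),
        vprod ν := by
  classical
  have hsum := (Matrix.detRowAlternating (n := Fin N) (R := ℤ)).toMultilinearMap.map_sum_finset
    (fun (i : Fin N) (k : ℤ) (j : Fin N) => (descPochhammer ℤ (j : ℕ)).eval (((i : ℕ) : ℤ) - k))
    (fun i => Finset.Icc (lam.1 i.succ) (lam.1 i.castSucc))
  have hfac : ((Nat.factorial N : ℕ) : ℤ) = ∏ j : Fin N, (((j : ℕ) : ℤ) + 1) := by
    rw [← Finset.prod_range_add_one_eq_factorial, Finset.prod_range]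
    push_cast
    rfl
  simp only [vprod_eq_det_descPochhammer (N := N)]
  refine Eq.trans ?_ (congrArg (((Nat.factorial N : ℕ) : ℤ) * ·) hsum)
  rw [vprod_eq_det_sub, hfac]
  refine Eq.trans ?_ (Matrix.det_mul_row (fun j : Fin N => ((j : ℕ) : ℤ) + 1) _)
  congr 1
  ext i j
  simp only [Matrix.of_apply, Finset.sum_apply]
  exact (sum_Icc_eval_descPochhammer _ _ (lam.2 _ _ (Fin.castSucc_lt_succ).le)).symm

theorem finsum_interlace {N : ℕ} {M : Type*} [AddCommMonoid M] (lam : Sig (N + 1))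
    (g : (Fin N → ℤ) → M) :
    ∑ᶠ ν : Sig N, (if Interlace ν lam then g ν.1 else 0) =
      ∑ ν ∈ Fintype.piFinset fun i : Fin N => Finset.Icc (lam.1 i.succ) (lam.1 i.castSucc),
        g ν := by
  classical
  set s := Fintype.piFinset fun i : Fin N => Finset.Icc (lam.1 i.succ) (lam.1 i.castSucc) with hs
  have hmem (f : Fin N → ℤ) :
      f ∈ s ↔ ∀ i : Fin N, lam.1 i.succ ≤ f i ∧ f i ≤ lam.1 i.castSucc := by simp [hs]
  have hsig : ∀ f ∈ s, ∀ i j : Fin N, i ≤ j → f j ≤ f i := by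
    intro f hf i j hij
    rw [hmem] at hf
    obtain rfl | hlt := hij.eq_or_lt
    · rfl
    · exact ((hf j).2.trans (lam.2 i.succ j.castSucc (by simpa [Fin.le_def] using hlt))).trans
        (hf i).1
  let t : Finset (Sig N) :=
    Finset.subtype (fun f : Fin N → ℤ => ∀ i j : Fin N, i ≤ j → f j ≤ f i) s
  have ht (ν : Sig N) : ν ∈ t ↔ Interlace ν lam := Finset.mem_subtype.trans (hmem ν.1)
  rw [finsum_eq_sum_of_support_subset (s := t)]
  · rw [Finset.sum_congr rfl fun ν hν => if_pos ((ht ν).1 hν)]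
    exact Finset.sum_subtype_of_mem g hsig
  · intro ν hν
    rw [Finset.mem_coe, ht]
    by_contra h
    simp [h] at hν

theorem vprod_pos {N : ℕ} (lam : Sig N) : 0 < vprod lam.1 := by
  refine Finset.prod_pos fun i _ => Finset.prod_pos fun j _ => ?_
  split_ifs with h
  · have := lam.2 i j h.le
    have : (i : ℕ) < (j : ℕ) := h
    lia
  · exact one_pos

/-- For every `N ≥ 1` and `λ ∈ GT_{N+1}`:
`∏_{1≤i<j≤N+1}(λ_i−i−λ_j+j) = N! · Σ_{ν ≺ λ} ∏_{1≤i<j≤N}(ν_i−i−ν_j+j)`;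
equivalently, the link is a stochastic matrix: `Σ_ν Λ^{N+1}_N(λ,ν) = 1`. -/
theorem stmt0 (N : ℕ) (hN : 1 ≤ N) (lam : Sig (N + 1)) :
    (vprod lam.1 =
      (Nat.factorial N : ℤ) *
        ∑ᶠ ν : Sig N, (if Interlace ν lam then vprod ν.1 else 0)) ∧
    (∑ᶠ ν : Sig N, link lam ν = 1) := by
  have key := vprod_eq_factorial_mul_sum_piFinset lam
  refine ⟨by rw [finsum_interlace lam vprod, key], ?_⟩
  unfold link
  rw [finsum_interlace lam fun f => (Nat.factorial N : ℝ) * (vprod f : ℝ) / (vprod lam.1 : ℝ),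
    ← Finset.sum_div, ← Finset.mul_sum,
    div_eq_one_iff_eq (Int.cast_ne_zero.2 (vprod_pos lam).ne'), key]
  push_cast
  rfl
end

section
/- For every N ≥ 1 and every function f : GT_N → ℝ that tends to 0 along the cofinite filter on the countable set GT_N, the function λ ↦ Σ_{ν∈GT_N} Λ^{N+1}_N(λ,ν) f(ν) (a sum with finitely many nonzero terms for each λ) tends to 0 along the cofinite filter on GT_{N+1}. In other words, the operator induced by the Markov kernel Λ^{N+1}_N maps C₀(GT_N) into C₀(GT_{N+1}), i.e. Λ^{N+1}_N is a Feller kernel. -/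
theorem Sig.factor_pos {N : ℕ} (lam : Sig N) {i j : Fin N} (h : i < j) :
    0 < lam.1 i - (i : ℕ) - lam.1 j + (j : ℕ) := by
  have h1 := lam.2 i j h.le
  have h2 : (i : ℕ) < (j : ℕ) := h
  omega

theorem sub_le_vprod {N : ℕ} (lam : Sig N) {i j : Fin N} (h : i < j) :
    lam.1 i - lam.1 j ≤ vprod lam.1 := by
  have hdvd : lam.1 i - (i : ℕ) - lam.1 j + (j : ℕ) ∣ vprod lam.1 := by
    refine Dvd.dvd.trans ?_ (Finset.dvd_prod_of_mem _ (Finset.mem_univ i))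
    refine Dvd.dvd.trans ?_ (Finset.dvd_prod_of_mem _ (Finset.mem_univ j))
    rw [if_pos h]
  have h1 := Int.le_of_dvd (vprod_pos lam) hdvd
  have h2 : (i : ℕ) < (j : ℕ) := h
  omega

theorem link_nonneg {N : ℕ} (lam : Sig (N + 1)) (ν : Sig N) : 0 ≤ link lam ν := by
  have h1 : (0 : ℝ) < vprod lam.1 := by exact_mod_cast vprod_pos lam
  have h2 : (0 : ℝ) < vprod ν.1 := by exact_mod_cast vprod_pos ν
  unfold link
  split_ifs <;> positivity

/-- The finite set of signatures interlacing with `lam`. -/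
noncomputable def interlacing {N : ℕ} (lam : Sig (N + 1)) : Finset (Sig N) :=
  (Finset.Icc (fun i : Fin N => lam.1 i.succ) (fun i : Fin N => lam.1 i.castSucc)).preimage
    Subtype.val Subtype.val_injective.injOn

theorem mem_interlacing {N : ℕ} {lam : Sig (N + 1)} {ν : Sig N} :
    ν ∈ interlacing lam ↔ Interlace ν lam := by
  exact Finset.mem_preimage.trans (Finset.mem_Icc.trans forall_and.symm)

theorem card_interlacing_le {N : ℕ} (lam : Sig (N + 1)) :
    ((interlacing lam).card : ℤ) ≤ ∏ i : Fin N, (lam.1 i.castSucc - lam.1 i.succ + 1) := by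
  have h : (interlacing lam).card ≤ (Finset.Icc (fun i : Fin N => lam.1 i.succ)
      (fun i : Fin N => lam.1 i.castSucc)).card :=
    Finset.card_le_card_of_injOn Subtype.val (fun _ hν => Finset.mem_preimage.1 hν)
      Subtype.val_injective.injOn
  refine (Nat.cast_le.2 h).trans_eq ?_
  rw [Pi.card_Icc, Nat.cast_prod]
  refine Finset.prod_congr rfl fun i _ => ?_
  have := lam.2 i.castSucc i.succ i.castSucc_le_succ
  rw [Int.card_Icc]
  omega

theorem vprod_succ {N : ℕ} (g : Fin (N + 1) → ℤ) :
    vprod g = (∏ i : Fin N, (g i.castSucc - g i.succ + 1)) *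
      ∏ i : Fin N, ∏ j : Fin N,
        if i < j then (g i.castSucc - (i : ℕ) - g j.succ + (j : ℕ) + 1) else 1 := by
  have hlast : ∀ j : Fin (N + 1), ¬ Fin.last N < j := fun j => (Fin.le_last j).not_gt
  rw [vprod, Fin.prod_univ_castSucc]
  simp only [hlast, if_false, Finset.prod_const_one, mul_one]
  rw [← Finset.prod_mul_distrib]
  refine Finset.prod_congr rfl fun i _ => ?_
  have hdiag : g i.castSucc - g i.succ + 1 =
      ∏ j : Fin N, if j = i then g j.castSucc - g j.succ + 1 else 1 := by
    rw [Finset.prod_ite_eq', if_pos (Finset.mem_univ i)]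
  rw [Fin.prod_univ_succ, if_neg (Fin.not_lt_zero _), one_mul, hdiag, ← Finset.prod_mul_distrib]
  refine Finset.prod_congr rfl fun j _ => ?_
  rcases lt_trichotomy i j with h | rfl | h
  · rw [if_pos (Fin.castSucc_lt_succ_iff.2 h.le), if_neg h.ne', if_pos h]
    push_cast [Fin.val_castSucc, Fin.val_succ]
    ring
  · rw [if_pos Fin.castSucc_lt_succ, if_pos rfl, if_neg (lt_irrefl _)]
    push_cast [Fin.val_castSucc, Fin.val_succ]
    ring
  · rw [if_neg (mt Fin.castSucc_lt_succ_iff.1 h.not_ge), if_neg h.ne, if_neg h.not_gt, one_mul]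

theorem vprod_le_of_interlace {N : ℕ} {lam : Sig (N + 1)} {ν : Sig N} (h : Interlace ν lam) :
    vprod ν.1 ≤ ∏ i : Fin N, ∏ j : Fin N,
      if i < j then (lam.1 i.castSucc - (i : ℕ) - lam.1 j.succ + (j : ℕ) + 1) else 1 := by
  have hnn : ∀ i j : Fin N,
      0 ≤ if i < j then (ν.1 i - (i : ℕ) - ν.1 j + (j : ℕ)) else 1 := by
    intro i j
    split_ifs with hij
    exacts [(ν.factor_pos hij).le, zero_le_one]
  refine Finset.prod_le_prod (fun i _ => Finset.prod_nonneg fun j _ => hnn i j) fun i _ =>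
    Finset.prod_le_prod (fun j _ => hnn i j) fun j _ => ?_
  have h1 := (h i).2
  have h2 := (h j).1
  split_ifs <;> omega

theorem sum_vprod_le {N : ℕ} (lam : Sig (N + 1)) :
    ∑ ν ∈ interlacing lam, vprod ν.1 ≤ vprod lam.1 := by
  have hle := Finset.sum_le_card_nsmul (interlacing lam) (fun ν => vprod ν.1) _
    fun ν hν => vprod_le_of_interlace (mem_interlacing.1 hν)
  rw [nsmul_eq_mul] at hle
  rw [vprod_succ]
  refine hle.trans (mul_le_mul_of_nonneg_right (card_interlacing_le lam) ?_)
  refine Finset.prod_nonneg fun i _ => Finset.prod_nonneg fun j _ => ?_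
  split_ifs with hij
  · have h1 := lam.2 i.castSucc j.succ (Fin.le_def.2 (by simp; omega))
    omega
  · exact zero_le_one

/-- The total mass of the link is bounded by `N!` (it is in fact equal to `1`). -/
theorem sum_link_le {N : ℕ} (lam : Sig (N + 1)) :
    ∑ ν ∈ interlacing lam, link lam ν ≤ N.factorial := by
  have hpos : (0 : ℝ) < vprod lam.1 := by exact_mod_cast vprod_pos lam
  have hle : ∑ ν ∈ interlacing lam, (vprod ν.1 : ℝ) ≤ vprod lam.1 := by
    exact_mod_cast sum_vprod_le lam
  have heq : ∑ ν ∈ interlacing lam, link lam ν =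
      N.factorial * (∑ ν ∈ interlacing lam, (vprod ν.1 : ℝ)) / vprod lam.1 := by
    rw [Finset.mul_sum, Finset.sum_div]
    exact Finset.sum_congr rfl fun ν hν => if_pos (mem_interlacing.1 hν)
  rw [heq, div_le_iff₀ hpos]
  gcongr

theorem Sig.finite_bounded {N : ℕ} (a b : ℤ) :
    {lam : Sig N | ∀ i, a ≤ lam.1 i ∧ lam.1 i ≤ b}.Finite := by
  refine ((Set.finite_Icc (fun _ : Fin N => a) (fun _ => b)).preimage
    (f := (Subtype.val : Sig N → Fin N → ℤ)) Subtype.val_injective.injOn).subset fun lam h => ?_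
  exact ⟨fun i => (h i).1, fun i => (h i).2⟩

theorem tendsto_link {N : ℕ} (hN : 1 ≤ N) (ν : Sig N) :
    Filter.Tendsto (fun lam : Sig (N + 1) => link lam ν) Filter.cofinite (nhds 0) := by
  obtain ⟨m, rfl⟩ : ∃ m, N = m + 1 := ⟨N - 1, by omega⟩
  rw [Metric.tendsto_nhds]
  intro ε hε
  obtain ⟨K, hK⟩ := exists_int_gt (((m + 1).factorial * vprod ν.1 : ℝ) / ε)
  rw [Filter.eventually_cofinite]
  refine (Sig.finite_bounded (ν.1 0 - K) (ν.1 0 + K)).subset fun lam hlam => ?_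
  have hpos : (0 : ℝ) < vprod lam.1 := by exact_mod_cast vprod_pos lam
  rw [Set.mem_ofPred_eq, Real.dist_0_eq_abs, abs_of_nonneg (link_nonneg lam ν), not_lt] at hlam
  have hint : Interlace ν lam := by
    by_contra h
    rw [link, if_neg h] at hlam
    exact hlam.not_gt hε
  rw [link, if_pos hint, le_div_iff₀ hpos, mul_comm, ← le_div_iff₀ hε] at hlam
  have hvK : vprod lam.1 ≤ K := by exact_mod_cast hlam.trans hK.le
  have hdiff := (sub_le_vprod lam (Fin.last_pos : (0 : Fin (m + 2)) < Fin.last (m + 1))).trans hvK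
  have h0 : ν.1 0 ≤ lam.1 0 := (hint 0).2
  have h1 : lam.1 (Fin.last (m + 1)) ≤ ν.1 0 := (lam.2 _ _ (Fin.le_last _)).trans (hint 0).1
  intro i
  have h2 := lam.2 _ _ (Fin.le_last i)
  have h3 := lam.2 _ _ (Fin.zero_le i)
  omega

/-- The operator induced by the Markov kernel `Λ^{N+1}_N` maps `C₀(GT_N)` into
`C₀(GT_{N+1})`: if `f : GT_N → ℝ` tends to `0` along the cofinite filter, then so does
`λ ↦ Σ_ν Λ^{N+1}_N(λ,ν) f(ν)` on `GT_{N+1}`.  That is, `Λ^{N+1}_N` is a Feller kernel. -/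
theorem stmt1 (N : ℕ) (hN : 1 ≤ N) (f : Sig N → ℝ)
    (hf : Filter.Tendsto f Filter.cofinite (nhds 0)) :
    Filter.Tendsto (fun lam : Sig (N + 1) => ∑ᶠ ν : Sig N, link lam ν * f ν)
      Filter.cofinite (nhds 0) := by
  classical
  have hsum : ∀ lam : Sig (N + 1),
      ∑ᶠ ν : Sig N, link lam ν * f ν = ∑ ν ∈ interlacing lam, link lam ν * f ν := by
    refine fun lam => finsum_eq_sum_of_support_subset _ fun ν hν => ?_
    rw [Finset.mem_coe, mem_interlacing]
    by_contra h
    exact hν (by simp only [link, if_neg h, zero_mul])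
  simp only [hsum]
  rw [Metric.tendsto_nhds]
  intro ε hε
  have hfac : (0 : ℝ) < N.factorial := by exact_mod_cast N.factorial_pos
  set δ : ℝ := ε / (2 * N.factorial) with hδ
  have hδ0 : 0 < δ := by positivity
  have hfin : {ν | ¬ dist (f ν) 0 < δ}.Finite := Metric.tendsto_nhds.1 hf δ hδ0
  have hlim : Filter.Tendsto (fun lam : Sig (N + 1) => ∑ ν ∈ hfin.toFinset, link lam ν * |f ν|)
      Filter.cofinite (nhds 0) := by
    simpa using tendsto_finsetSum hfin.toFinset
      fun ν _ => (tendsto_link hN ν).mul_const |f ν|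
  filter_upwards [hlim.eventually_lt_const (half_pos hε)] with lam hlam
  have hterm : ∀ ν ∈ interlacing lam, |link lam ν * f ν| ≤
      (if ν ∈ hfin.toFinset then link lam ν * |f ν| else 0) + link lam ν * δ := by
    intro ν _
    have hl := link_nonneg lam ν
    rw [abs_mul, abs_of_nonneg hl]
    split_ifs with h
    · exact le_add_of_nonneg_right (by positivity)
    · rw [zero_add]
      have h' : |f ν| < δ := by simpa using h
      gcongr
  rw [Real.dist_0_eq_abs]
  calc |∑ ν ∈ interlacing lam, link lam ν * f ν|
      ≤ ∑ ν ∈ interlacing lam, |link lam ν * f ν| := Finset.abs_sum_le_sum_abs _ _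
    _ ≤ ∑ ν ∈ interlacing lam, ((if ν ∈ hfin.toFinset then link lam ν * |f ν| else 0) +
          link lam ν * δ) := Finset.sum_le_sum hterm
    _ = (∑ ν ∈ interlacing lam with ν ∈ hfin.toFinset, link lam ν * |f ν|) +
          (∑ ν ∈ interlacing lam, link lam ν) * δ := by
        rw [Finset.sum_add_distrib, Finset.sum_filter, Finset.sum_mul]
    _ ≤ (∑ ν ∈ hfin.toFinset, link lam ν * |f ν|) + N.factorial * δ := by
        refine add_le_add (Finset.sum_le_sum_of_subset_of_nonneg
          (fun ν hν => (Finset.mem_filter.1 hν).2)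
          fun ν _ _ => mul_nonneg (link_nonneg lam ν) (abs_nonneg _)) ?_
        exact mul_le_mul_of_nonneg_right (sum_link_le lam) hδ0.le
    _ < ε / 2 + N.factorial * δ := by gcongr
    _ = ε := by rw [hδ]; field_simp; ring
end

section
/- For every n ∈ ℤ and every ε > 0 there exists C > 0 such that every ω = (α⁺,β⁺,α⁻,β⁻,δ⁺,δ⁻) ∈ Ω with δ⁺ + δ⁻ ≥ C satisfies |φ_n(ω)| ≤ ε. In other words, for each fixed n ∈ ℤ the Fourier coefficient φ_n(ω) of Φ_ω tends to 0 as ω tends to infinity in Ω (which is equivalent to δ⁺ + δ⁻ → +∞). -/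
open scoped Real

/-- A point of the boundary `Ω` of the Gelfand–Tsetlin graph: a sextuple
`ω = (α⁺, β⁺, α⁻, β⁻, δ⁺, δ⁻)` of nonincreasing nonnegative sequences and nonnegative
reals with `Σ_i (α_i^± + β_i^±) ≤ δ^±` and `β₁⁺ + β₁⁻ ≤ 1` (sequences indexed from 0). -/
structure OmegaPt : Type where
  alphaP : ℕ → ℝ
  betaP : ℕ → ℝ
  alphaM : ℕ → ℝ
  betaM : ℕ → ℝ
  deltaP : ℝ
  deltaM : ℝ
  alphaP_anti : Antitone alphaP
  betaP_anti : Antitone betaP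
  alphaM_anti : Antitone alphaM
  betaM_anti : Antitone betaM
  alphaP_nonneg : ∀ i, 0 ≤ alphaP i
  betaP_nonneg : ∀ i, 0 ≤ betaP i
  alphaM_nonneg : ∀ i, 0 ≤ alphaM i
  betaM_nonneg : ∀ i, 0 ≤ betaM i
  sumP_le : ∀ n : ℕ, (∑ i ∈ Finset.range n, (alphaP i + betaP i)) ≤ deltaP
  sumM_le : ∀ n : ℕ, (∑ i ∈ Finset.range n, (alphaM i + betaM i)) ≤ deltaM
  beta_le_one : betaP 0 + betaM 0 ≤ 1

/-- `γ⁺ = δ⁺ − Σ_i (α_i⁺ + β_i⁺)`. -/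
noncomputable def OmegaPt.gammaP (ω : OmegaPt) : ℝ :=
  ω.deltaP - ∑' i, (ω.alphaP i + ω.betaP i)

/-- `γ⁻ = δ⁻ − Σ_i (α_i⁻ + β_i⁻)`. -/
noncomputable def OmegaPt.gammaM (ω : OmegaPt) : ℝ :=
  ω.deltaM - ∑' i, (ω.alphaM i + ω.betaM i)

/-- The characteristic function `Φ_ω(u)` of a boundary point `ω ∈ Ω`, for `|u| = 1`. -/
noncomputable def PhiOmega (ω : OmegaPt) (u : ℂ) : ℂ :=
  Complex.exp ((ω.gammaP : ℂ) * (u - 1) + (ω.gammaM : ℂ) * (u⁻¹ - 1)) *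
    ∏' i : ℕ,
      ((1 + (ω.betaP i : ℂ) * (u - 1)) / (1 - (ω.alphaP i : ℂ) * (u - 1)) *
        ((1 + (ω.betaM i : ℂ) * (u⁻¹ - 1)) / (1 - (ω.alphaM i : ℂ) * (u⁻¹ - 1))))

/-- The `n`-th Laurent (Fourier) coefficient `φ_n(ω)` of `Φ_ω` on the unit circle. -/
noncomputable def phiCoef (n : ℤ) (ω : OmegaPt) : ℂ :=
  ((1 / (2 * π) : ℝ) : ℂ) *
    ∫ θ in (0 : ℝ)..(2 * π),
      PhiOmega ω (Complex.exp (θ * Complex.I)) * Complex.exp (-(n : ℂ) * θ * Complex.I)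

open Filter Topology Finset

/-- A function of the angle `θ` which is bounded by `(1 + 2 d (1 - cos θ))^(-1/2)` and which a shift
of the angle by `h` multiplies by `exp (i h m)`, up to an error of `2 d |h|`. -/
structure HasWeight (f : ℝ → ℂ) (d m : ℝ) : Prop where
  weight_nonneg : 0 ≤ d
  decay : ∀ θ : ℝ, ‖f θ‖ ^ 2 * (1 + 2 * d * (1 - Real.cos θ)) ≤ 1
  shift : ∀ θ h : ℝ, ‖f (θ + h) - Complex.exp ((h * m : ℝ) * Complex.I) * f θ‖ ≤ 2 * d * |h|

namespace HasWeight

variable {f g : ℝ → ℂ} {d e m k : ℝ}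

theorem norm_le_one (hf : HasWeight f d m) (θ : ℝ) : ‖f θ‖ ≤ 1 := by
  have h1 := hf.decay θ
  have h2 : 0 ≤ 2 * d * (1 - Real.cos θ) :=
    mul_nonneg (by linarith [hf.weight_nonneg]) (by linarith [Real.cos_le_one θ])
  nlinarith [norm_nonneg (f θ), mul_nonneg (sq_nonneg ‖f θ‖) h2]

theorem norm_le (hf : HasWeight f d m) (θ : ℝ) :
    ‖f θ‖ ≤ (√(1 + 2 * d * (1 - Real.cos θ)))⁻¹ := by
  have h2 : 0 ≤ 2 * d * (1 - Real.cos θ) :=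
    mul_nonneg (by linarith [hf.weight_nonneg]) (by linarith [Real.cos_le_one θ])
  rw [← Real.sqrt_inv]
  apply Real.le_sqrt_of_sq_le
  rw [← one_div, le_div_iff₀ (by linarith)]
  exact hf.decay θ

theorem mul (hf : HasWeight f d m) (hg : HasWeight g e k) :
    HasWeight (fun θ => f θ * g θ) (d + e) (m + k) where
  weight_nonneg := add_nonneg hf.weight_nonneg hg.weight_nonneg
  decay θ := by
    have hs : 0 ≤ 1 - Real.cos θ := by linarith [Real.cos_le_one θ]
    have hx := mul_nonneg hf.weight_nonneg hs
    have hy := mul_nonneg hg.weight_nonneg hs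
    rw [norm_mul]
    calc (‖f θ‖ * ‖g θ‖) ^ 2 * (1 + 2 * (d + e) * (1 - Real.cos θ))
        ≤ (‖f θ‖ * ‖g θ‖) ^ 2 *
          ((1 + 2 * d * (1 - Real.cos θ)) * (1 + 2 * e * (1 - Real.cos θ))) := by
          gcongr
          nlinarith [mul_nonneg hx hy]
      _ = (‖f θ‖ ^ 2 * (1 + 2 * d * (1 - Real.cos θ))) *
          (‖g θ‖ ^ 2 * (1 + 2 * e * (1 - Real.cos θ))) := by ring
      _ ≤ 1 := mul_le_one₀ (hf.decay θ)
          (mul_nonneg (sq_nonneg _) (by linarith)) (hg.decay θ)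
  shift θ h := by
    have hexp : Complex.exp ((h * (m + k) : ℝ) * Complex.I) =
        Complex.exp ((h * m : ℝ) * Complex.I) * Complex.exp ((h * k : ℝ) * Complex.I) := by
      rw [← Complex.exp_add]; congr 1; push_cast; ring
    rw [hexp]
    set a := Complex.exp ((h * m : ℝ) * Complex.I) with ha
    set b := Complex.exp ((h * k : ℝ) * Complex.I) with hb
    have hb1 : ‖b‖ = 1 := Complex.norm_exp_ofReal_mul_I _
    calc ‖f (θ + h) * g (θ + h) - a * b * (f θ * g θ)‖
        = ‖f (θ + h) * (g (θ + h) - b * g θ) + b * g θ * (f (θ + h) - a * f θ)‖ := by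
          congr 1; ring
      _ ≤ ‖f (θ + h)‖ * ‖g (θ + h) - b * g θ‖ + ‖b‖ * ‖g θ‖ * ‖f (θ + h) - a * f θ‖ := by
          refine (norm_add_le _ _).trans ?_
          simp only [norm_mul, le_refl]
      _ ≤ 1 * (2 * e * |h|) + 1 * 1 * (2 * d * |h|) := by
          rw [hb1]
          have := hf.norm_le_one (θ + h)
          have := hg.norm_le_one θ
          have := hg.shift θ h
          have := hf.shift θ h
          gcongr
      _ = 2 * (d + e) * |h| := by ring

theorem comp_neg (hf : HasWeight f d m) : HasWeight (fun θ => f (-θ)) d (-m) where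
  weight_nonneg := hf.weight_nonneg
  decay θ := by simpa using hf.decay (-θ)
  shift θ h := by
    have := hf.shift (-θ) (-h)
    rw [abs_neg] at this
    rw [neg_add, mul_neg, ← neg_mul]
    exact this

theorem one : HasWeight (fun _ => 1) 0 0 where
  weight_nonneg := le_rfl
  decay θ := by simp
  shift θ h := by simp

theorem prod_range {F : ℕ → ℝ → ℂ} {d m : ℕ → ℝ} (hF : ∀ i, HasWeight (F i) (d i) (m i)) (n : ℕ) :
    HasWeight (fun θ => ∏ i ∈ range n, F i θ) (∑ i ∈ range n, d i) (∑ i ∈ range n, m i) := by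
  induction n with
  | zero => simpa using one
  | succ n ih =>
    simp only [prod_range_succ, sum_range_succ]
    exact ih.mul (hF n)

theorem of_tendsto {F : ℕ → ℝ → ℂ} {D M : ℕ → ℝ} (hF : ∀ n, HasWeight (F n) (D n) (M n))
    (hf : ∀ θ, Tendsto (fun n => F n θ) atTop (𝓝 (f θ))) (hD : Tendsto D atTop (𝓝 d))
    (hM : Tendsto M atTop (𝓝 m)) : HasWeight f d m where
  weight_nonneg := ge_of_tendsto' hD fun n => (hF n).weight_nonneg
  decay θ := by
    refine le_of_tendsto' (x := atTop) (f := fun n => ‖F n θ‖ ^ 2 *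
      (1 + 2 * D n * (1 - Real.cos θ))) ?_ fun n => (hF n).decay θ
    exact ((hf θ).norm.pow 2).mul (((hD.const_mul 2).mul_const _).const_add 1)
  shift θ h := by
    refine le_of_tendsto_of_tendsto' (f := fun n => ‖F n (θ + h) -
      Complex.exp ((h * M n : ℝ) * Complex.I) * F n θ‖) (g := fun n => 2 * D n * |h|) ?_
      ((hD.const_mul 2).mul_const _) fun n => (hF n).shift θ h
    refine ((hf _).sub (Tendsto.mul ?_ (hf θ))).norm
    have hc : Continuous fun x : ℝ => Complex.exp ((h * x : ℝ) * Complex.I) := by fun_prop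
    exact (hc.tendsto m).comp hM

theorem tprod {F : ℕ → ℝ → ℂ} {d m : ℕ → ℝ} (hF : ∀ i, HasWeight (F i) (d i) (m i))
    (hmul : ∀ θ, Multipliable fun i => F i θ) (hd : Summable d) (hm : Summable m) :
    HasWeight (fun θ => ∏' i, F i θ) (∑' i, d i) (∑' i, m i) :=
  of_tendsto (prod_range hF) (fun θ => (hmul θ).hasProd.tendsto_prod_nat)
    hd.hasSum.tendsto_sum_nat hm.hasSum.tendsto_sum_nat

end HasWeight

theorem norm_exp_ofReal_mul_I_sub_one_le (x : ℝ) : ‖Complex.exp (x * Complex.I) - 1‖ ≤ |x| := by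
  rw [mul_comm]
  exact Real.norm_exp_I_mul_ofReal_sub_one_le

theorem norm_exp_ofReal_mul_I_sub_exp_le (x y : ℝ) :
    ‖Complex.exp (x * Complex.I) - Complex.exp (y * Complex.I)‖ ≤ |x - y| := by
  have : Complex.exp (x * Complex.I) - Complex.exp (y * Complex.I) =
      Complex.exp (y * Complex.I) * (Complex.exp ((x - y : ℝ) * Complex.I) - 1) := by
    rw [mul_sub, ← Complex.exp_add, mul_one]
    congr 2
    push_cast
    ring
  rw [this, norm_mul, Complex.norm_exp_ofReal_mul_I, one_mul]
  exact norm_exp_ofReal_mul_I_sub_one_le _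

theorem norm_one_add_mul_exp_sub_one_sq (b θ : ℝ) :
    ‖(1 + b * (Complex.exp (θ * Complex.I) - 1) : ℂ)‖ ^ 2 =
      1 - 2 * (b * (1 - b)) * (1 - Real.cos θ) := by
  have hre : (1 + b * (Complex.exp (θ * Complex.I) - 1) : ℂ).re = 1 + b * (Real.cos θ - 1) := by
    rw [Complex.add_re, Complex.re_ofReal_mul, Complex.sub_re, Complex.exp_ofReal_mul_I_re,
      Complex.one_re]
  have him : (1 + b * (Complex.exp (θ * Complex.I) - 1) : ℂ).im = b * Real.sin θ := by
    rw [Complex.add_im, Complex.im_ofReal_mul, Complex.sub_im, Complex.exp_ofReal_mul_I_im,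
      Complex.one_im, sub_zero, zero_add]
  rw [Complex.sq_norm, Complex.normSq_apply, hre, him]
  linear_combination b ^ 2 * Real.sin_sq_add_cos_sq θ

theorem hasWeight_one_add_mul {b : ℝ} (h0 : 0 ≤ b) (h1 : b ≤ 1) :
    HasWeight (fun θ : ℝ => (1 + b * (Complex.exp (θ * Complex.I) - 1) : ℂ)) (b * (1 - b)) b where
  weight_nonneg := mul_nonneg h0 (by linarith)
  decay θ := by
    rw [norm_one_add_mul_exp_sub_one_sq]
    nlinarith [sq_nonneg (2 * (b * (1 - b)) * (1 - Real.cos θ))]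
  shift θ h := by
    have key : (1 + b * (Complex.exp ((θ + h : ℝ) * Complex.I) - 1) : ℂ) -
        Complex.exp ((h * b : ℝ) * Complex.I) * (1 + b * (Complex.exp (θ * Complex.I) - 1)) =
        ((1 - b : ℝ) : ℂ) * (1 - Complex.exp ((h * b : ℝ) * Complex.I)) +
        b * (Complex.exp (θ * Complex.I) * (Complex.exp ((h : ℝ) * Complex.I) -
          Complex.exp ((h * b : ℝ) * Complex.I))) := by
      have : Complex.exp ((θ + h : ℝ) * Complex.I) =
          Complex.exp (θ * Complex.I) * Complex.exp (h * Complex.I) := by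
        rw [← Complex.exp_add]; congr 1; push_cast; ring
      rw [this, Complex.ofReal_sub, Complex.ofReal_one]
      ring
    rw [key]
    refine (norm_add_le _ _).trans ?_
    rw [norm_mul, norm_mul, norm_mul, Complex.norm_exp_ofReal_mul_I, Complex.norm_real,
      Complex.norm_real, norm_sub_rev (1 : ℂ), Real.norm_of_nonneg h0,
      Real.norm_of_nonneg (by linarith : 0 ≤ 1 - b), one_mul]
    have e1 := norm_exp_ofReal_mul_I_sub_one_le (h * b)
    have e2 := norm_exp_ofReal_mul_I_sub_exp_le h (h * b)
    rw [abs_mul, abs_of_nonneg h0] at e1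
    rw [show h - h * b = h * (1 - b) by ring, abs_mul,
      abs_of_nonneg (by linarith : 0 ≤ 1 - b)] at e2
    nlinarith [mul_le_mul_of_nonneg_left e1 (by linarith : 0 ≤ 1 - b),
      mul_le_mul_of_nonneg_left e2 h0]

theorem norm_one_sub_mul_exp_sub_one_sq (a θ : ℝ) :
    ‖(1 - a * (Complex.exp (θ * Complex.I) - 1) : ℂ)‖ ^ 2 =
      1 + 2 * (a * (1 + a)) * (1 - Real.cos θ) := by
  have := norm_one_add_mul_exp_sub_one_sq (-a) θ
  rw [Complex.ofReal_neg, neg_mul, ← sub_eq_add_neg] at this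
  rw [this]
  ring

theorem one_le_norm_one_sub_mul {a : ℝ} (h0 : 0 ≤ a) (θ : ℝ) :
    1 ≤ ‖(1 - a * (Complex.exp (θ * Complex.I) - 1) : ℂ)‖ := by
  have h := norm_one_sub_mul_exp_sub_one_sq a θ
  have h2 : 0 ≤ 2 * (a * (1 + a)) * (1 - Real.cos θ) :=
    mul_nonneg (by positivity) (by linarith [Real.cos_le_one θ])
  nlinarith [norm_nonneg (1 - a * (Complex.exp (θ * Complex.I) - 1) : ℂ)]

theorem hasWeight_inv_one_sub_mul {a : ℝ} (h0 : 0 ≤ a) :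
    HasWeight (fun θ : ℝ => (1 - a * (Complex.exp (θ * Complex.I) - 1) : ℂ)⁻¹) a 0 where
  weight_nonneg := h0
  decay θ := by
    have hn := one_le_norm_one_sub_mul h0 θ
    rw [norm_inv, inv_pow, inv_mul_le_iff₀ (by positivity), norm_one_sub_mul_exp_sub_one_sq]
    nlinarith [mul_nonneg (mul_self_nonneg a) (by linarith [Real.cos_le_one θ] :
      0 ≤ 1 - Real.cos θ)]
  shift θ h := by
    have hn := one_le_norm_one_sub_mul h0 θ
    have hn' := one_le_norm_one_sub_mul h0 (θ + h)
    have hz : (1 - a * (Complex.exp (θ * Complex.I) - 1) : ℂ) ≠ 0 :=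
      norm_pos_iff.1 (by linarith)
    have hz' : (1 - a * (Complex.exp ((θ + h : ℝ) * Complex.I) - 1) : ℂ) ≠ 0 :=
      norm_pos_iff.1 (by linarith)
    have e := norm_exp_ofReal_mul_I_sub_exp_le (θ + h) θ
    rw [add_sub_cancel_left] at e
    rw [mul_zero, Complex.ofReal_zero, zero_mul, Complex.exp_zero, one_mul, inv_sub_inv hz' hz,
      norm_div, norm_mul]
    refine (div_le_self (norm_nonneg _) (one_le_mul_of_one_le_of_one_le hn' hn)).trans ?_
    rw [show (1 - a * (Complex.exp (θ * Complex.I) - 1) : ℂ) -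
        (1 - a * (Complex.exp ((θ + h : ℝ) * Complex.I) - 1)) =
        a * (Complex.exp ((θ + h : ℝ) * Complex.I) - Complex.exp (θ * Complex.I)) by ring,
      norm_mul, Complex.norm_real, Real.norm_of_nonneg h0]
    nlinarith [mul_le_mul_of_nonneg_left e h0, mul_nonneg h0 (abs_nonneg h)]

theorem norm_exp_sub_exp_le_of_re_nonpos {z w : ℂ} (hz : z.re ≤ 0) (hw : w.re ≤ 0) :
    ‖Complex.exp z - Complex.exp w‖ ≤ ‖z - w‖ := by
  have := Convex.norm_image_sub_le_of_norm_deriv_le (f := Complex.exp) (C := 1)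
    (fun x _ => Complex.differentiable_exp x) (fun x hx => ?_) (convex_halfSpace_re_le 0)
    (show w ∈ {c : ℂ | c.re ≤ 0} from hw) (show z ∈ {c : ℂ | c.re ≤ 0} from hz)
  · rwa [one_mul] at this
  · rw [Complex.deriv_exp, Complex.norm_exp]
    exact Real.exp_le_one_iff.2 hx

theorem mul_exp_sub_one_re (c θ : ℝ) :
    (c * (Complex.exp (θ * Complex.I) - 1) : ℂ).re = -(c * (1 - Real.cos θ)) := by
  rw [Complex.re_ofReal_mul, Complex.sub_re, Complex.exp_ofReal_mul_I_re, Complex.one_re]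
  ring

theorem hasWeight_exp_mul {c : ℝ} (h0 : 0 ≤ c) :
    HasWeight (fun θ : ℝ => Complex.exp (c * (Complex.exp (θ * Complex.I) - 1))) c 0 where
  weight_nonneg := h0
  decay θ := by
    rw [Complex.norm_exp, mul_exp_sub_one_re, ← Real.exp_nat_mul]
    have := Real.add_one_le_exp (2 * c * (1 - Real.cos θ))
    calc _ ≤ Real.exp ((2 : ℕ) * -(c * (1 - Real.cos θ))) *
          Real.exp (2 * c * (1 - Real.cos θ)) := by gcongr; linarith
      _ = 1 := by
        rw [← Real.exp_add, Real.exp_eq_one_iff]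
        push_cast
        ring
  shift θ h := by
    have e := norm_exp_ofReal_mul_I_sub_exp_le (θ + h) θ
    rw [add_sub_cancel_left] at e
    rw [mul_zero, Complex.ofReal_zero, zero_mul, Complex.exp_zero, one_mul]
    have hre : ∀ x : ℝ, (c * (Complex.exp (x * Complex.I) - 1) : ℂ).re ≤ 0 := fun x => by
      rw [mul_exp_sub_one_re]
      nlinarith [mul_nonneg h0 (by linarith [Real.cos_le_one x] : 0 ≤ 1 - Real.cos x)]
    refine (norm_exp_sub_exp_le_of_re_nonpos (hre _) (hre _)).trans ?_
    rw [← mul_sub, sub_sub_sub_cancel_right, norm_mul, Complex.norm_real, Real.norm_of_nonneg h0]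
    nlinarith [mul_le_mul_of_nonneg_left e h0, mul_nonneg h0 (abs_nonneg h)]

/-- The bound for Fourier coefficients coming from a shift by a half period of
`exp (i (m - n) θ)`. -/
theorem HasWeight.norm_integral_mul_exp_mul_abs_le {f : ℝ → ℂ} {d m : ℝ} (hf : HasWeight f d m)
    (hper : Function.Periodic f (2 * π)) (n : ℤ) :
    ‖∫ θ in (0 : ℝ)..(2 * π), f θ * Complex.exp (-(n : ℂ) * θ * Complex.I)‖ * |m - n| ≤
      2 * π ^ 2 * d := by
  have hd := hf.weight_nonneg
  set g : ℝ → ℂ := fun θ => f θ * Complex.exp (-(n : ℂ) * θ * Complex.I) with hg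
  by_cases hint : IntervalIntegrable g MeasureTheory.volume 0 (2 * π)
  swap
  · rw [intervalIntegral.integral_undef hint]
    simp only [norm_zero, zero_mul]
    positivity
  rcases eq_or_ne (m - n) 0 with hmn | hmn
  · rw [hmn, abs_zero, mul_zero]
    positivity
  have hgper : Function.Periodic g (2 * π) := by
    intro θ
    simp only [hg, hper θ]
    congr 1
    rw [Complex.exp_eq_exp_iff_exists_int]
    exact ⟨-n, by push_cast; ring⟩
  set h : ℝ := π / (m - n) with hh
  have hint' : IntervalIntegrable (fun θ => g (θ + h)) MeasureTheory.volume 0 (2 * π) := by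
    have h1 := hgper.intervalIntegrable (t := 0) (by positivity) (by simpa using hint)
      (0 + h) (2 * π + h)
    simpa using h1.comp_add_right h
  have hshift : ∫ θ in (0 : ℝ)..(2 * π), g (θ + h) = ∫ θ in (0 : ℝ)..(2 * π), g θ := by
    rw [intervalIntegral.integral_comp_add_right]
    have := hgper.intervalIntegral_add_eq (0 + h) 0
    rw [zero_add (2 * π)] at this
    rw [← this]
    congr 1
    ring
  have hbound : ∀ θ : ℝ, ‖g (θ + h) + g θ‖ ≤ 2 * d * |h| := by
    intro θ
    have hE : Complex.exp (-(n : ℂ) * (θ + h : ℝ) * Complex.I) *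
        Complex.exp ((h * m : ℝ) * Complex.I) = -Complex.exp (-(n : ℂ) * θ * Complex.I) := by
      rw [← Complex.exp_add, show -(n : ℂ) * (θ + h : ℝ) * Complex.I + (h * m : ℝ) * Complex.I =
        -(n : ℂ) * θ * Complex.I + (h * (m - n) : ℝ) * Complex.I by push_cast; ring,
        hh, div_mul_cancel₀ _ hmn, Complex.exp_add, Complex.exp_pi_mul_I]
      ring
    have : g (θ + h) + g θ = Complex.exp (-(n : ℂ) * (θ + h : ℝ) * Complex.I) *
        (f (θ + h) - Complex.exp ((h * m : ℝ) * Complex.I) * f θ) := by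
      simp only [hg]
      linear_combination f θ * hE
    rw [this, norm_mul, show -(n : ℂ) * (θ + h : ℝ) * Complex.I =
      ((-n * (θ + h) : ℝ) : ℂ) * Complex.I by push_cast; ring, Complex.norm_exp_ofReal_mul_I,
      one_mul]
    exact hf.shift θ h
  have hI := intervalIntegral.norm_integral_le_of_norm_le_const (a := 0) (b := 2 * π)
    fun θ _ => hbound θ
  rw [intervalIntegral.integral_add hint' hint, hshift, ← two_mul, norm_mul, sub_zero,
    abs_of_pos Real.two_pi_pos, Complex.norm_ofNat, hh, abs_div, abs_of_pos Real.pi_pos] at hI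
  have hpos : 0 < |m - n| := abs_pos.2 hmn
  calc _ = (2 * ‖∫ θ in (0 : ℝ)..(2 * π), g θ‖) * |m - n| / 2 := by ring
    _ ≤ (2 * d * (π / |m - n|) * (2 * π)) * |m - n| / 2 := by gcongr
    _ = 2 * π ^ 2 * d := by field_simp

theorem tendsto_integral_inv_sqrt_one_add_mul :
    Tendsto (fun d : ℝ => ∫ θ in (0 : ℝ)..(2 * π), (√(1 + 2 * d * (1 - Real.cos θ)))⁻¹)
      atTop (𝓝 0) := by
  have key := intervalIntegral.tendsto_integral_filter_of_dominated_convergence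
    (a := 0) (b := 2 * π) (μ := MeasureTheory.volume) (l := atTop)
    (F := fun d θ : ℝ => (√(1 + 2 * d * (1 - Real.cos θ)))⁻¹) (f := fun _ => (0 : ℝ))
    (fun _ => (1 : ℝ)) ?_ ?_ ?_ ?_
  · simpa using key
  · exact Eventually.of_forall fun d => by
      apply Measurable.aestronglyMeasurable
      fun_prop
  · filter_upwards [eventually_ge_atTop 0] with d hd
    refine Eventually.of_forall fun θ _ => ?_
    rw [Real.norm_of_nonneg (by positivity)]
    apply inv_le_one_of_one_le₀
    rw [Real.one_le_sqrt]
    nlinarith [mul_nonneg hd (by linarith [Real.cos_le_one θ] : 0 ≤ 1 - Real.cos θ)]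
  · exact intervalIntegrable_const
  · have hne : ∀ᵐ θ : ℝ, θ ≠ 2 * π := by
      simp [MeasureTheory.ae_iff]
    filter_upwards [hne] with θ hθ hmem
    rw [Set.uIoc_of_le Real.two_pi_pos.le] at hmem
    have hcos : Real.cos θ < 1 := by
      refine lt_of_le_of_ne (Real.cos_le_one θ) fun h => ?_
      rw [Real.cos_eq_one_iff_of_lt_of_lt (by linarith [hmem.1, Real.pi_pos])
        (lt_of_le_of_ne hmem.2 hθ)] at h
      exact hmem.1.ne' h
    refine tendsto_inv_atTop_zero.comp (Real.tendsto_sqrt_atTop.comp ?_)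
    refine tendsto_atTop_add_const_left _ _ ?_
    exact (tendsto_id.const_mul_atTop (by norm_num : (0 : ℝ) < 2)).atTop_mul_const
      (by linarith)

theorem HasWeight.norm_integral_mul_exp_le {f : ℝ → ℂ} {d m : ℝ} (hf : HasWeight f d m) (n : ℤ) :
    ‖∫ θ in (0 : ℝ)..(2 * π), f θ * Complex.exp (-(n : ℂ) * θ * Complex.I)‖ ≤
      ∫ θ in (0 : ℝ)..(2 * π), (√(1 + 2 * d * (1 - Real.cos θ)))⁻¹ := by
  refine intervalIntegral.norm_integral_le_of_norm_le Real.two_pi_pos.le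
    (Eventually.of_forall fun θ _ => ?_) ?_
  · rw [norm_mul, show -(n : ℂ) * θ * Complex.I = ((-n * θ : ℝ) : ℂ) * Complex.I by push_cast; ring,
      Complex.norm_exp_ofReal_mul_I, mul_one]
    exact hf.norm_le θ
  · apply Continuous.intervalIntegrable
    have hpos : ∀ θ : ℝ, √(1 + 2 * d * (1 - Real.cos θ)) ≠ 0 := fun θ => by
      have := mul_nonneg hf.weight_nonneg (by linarith [Real.cos_le_one θ] : 0 ≤ 1 - Real.cos θ)
      exact (Real.sqrt_pos.2 (by linarith)).ne'
    exact Continuous.inv₀ (by fun_prop) hpos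

theorem multipliable_one_add_mul_div_one_sub_mul {a b : ℕ → ℝ} (ha : ∀ i, 0 ≤ a i)
    (hb : ∀ i, 0 ≤ b i) (hab : Summable fun i => a i + b i) (θ : ℝ) :
    Multipliable fun i => (1 + b i * (Complex.exp (θ * Complex.I) - 1) : ℂ) /
      (1 - a i * (Complex.exp (θ * Complex.I) - 1)) := by
  have h2 : ‖Complex.exp (θ * Complex.I) - 1‖ ≤ 2 := by
    refine (norm_sub_le _ _).trans ?_
    rw [Complex.norm_exp_ofReal_mul_I, norm_one]
    norm_num
  have key : ∀ i, (1 + b i * (Complex.exp (θ * Complex.I) - 1) : ℂ) /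
      (1 - a i * (Complex.exp (θ * Complex.I) - 1)) =
      1 + ((a i + b i : ℝ) : ℂ) * (Complex.exp (θ * Complex.I) - 1) /
        (1 - a i * (Complex.exp (θ * Complex.I) - 1)) := fun i => by
    have hn := one_le_norm_one_sub_mul (ha i) θ
    have hz : (1 - a i * (Complex.exp (θ * Complex.I) - 1) : ℂ) ≠ 0 :=
      norm_pos_iff.1 (by linarith)
    rw [div_eq_iff hz, add_mul, div_mul_cancel₀ _ hz, Complex.ofReal_add]
    ring
  simp only [key]
  apply multipliable_one_add_of_summable
  refine Summable.of_nonneg_of_le (fun i => norm_nonneg _) (fun i => ?_) (hab.mul_right 2)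
  have hn := one_le_norm_one_sub_mul (ha i) θ
  rw [norm_div, norm_mul, Complex.norm_real, Real.norm_of_nonneg (add_nonneg (ha i) (hb i))]
  refine (div_le_self (by have := ha i; have := hb i; positivity) hn).trans ?_
  have := add_nonneg (ha i) (hb i)
  gcongr

namespace OmegaPt

variable (ω : OmegaPt)

theorem summable_alphaP_add_betaP : Summable fun i => ω.alphaP i + ω.betaP i :=
  summable_of_sum_range_le (fun i => add_nonneg (ω.alphaP_nonneg i) (ω.betaP_nonneg i)) ω.sumP_le

theorem summable_alphaM_add_betaM : Summable fun i => ω.alphaM i + ω.betaM i :=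
  summable_of_sum_range_le (fun i => add_nonneg (ω.alphaM_nonneg i) (ω.betaM_nonneg i)) ω.sumM_le

theorem gammaP_nonneg : 0 ≤ ω.gammaP :=
  sub_nonneg.2 <| Real.tsum_le_of_sum_range_le
    (fun i => add_nonneg (ω.alphaP_nonneg i) (ω.betaP_nonneg i)) ω.sumP_le

theorem gammaM_nonneg : 0 ≤ ω.gammaM :=
  sub_nonneg.2 <| Real.tsum_le_of_sum_range_le
    (fun i => add_nonneg (ω.alphaM_nonneg i) (ω.betaM_nonneg i)) ω.sumM_le

theorem summable_alphaP : Summable ω.alphaP :=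
  ω.summable_alphaP_add_betaP.of_nonneg_of_le ω.alphaP_nonneg
    fun i => le_add_of_nonneg_right (ω.betaP_nonneg i)

theorem summable_betaP : Summable ω.betaP :=
  ω.summable_alphaP_add_betaP.of_nonneg_of_le ω.betaP_nonneg
    fun i => le_add_of_nonneg_left (ω.alphaP_nonneg i)

theorem summable_alphaM : Summable ω.alphaM :=
  ω.summable_alphaM_add_betaM.of_nonneg_of_le ω.alphaM_nonneg
    fun i => le_add_of_nonneg_right (ω.betaM_nonneg i)

theorem summable_betaM : Summable ω.betaM :=
  ω.summable_alphaM_add_betaM.of_nonneg_of_le ω.betaM_nonneg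
    fun i => le_add_of_nonneg_left (ω.alphaM_nonneg i)

theorem betaP_le_one (i : ℕ) : ω.betaP i ≤ 1 := by
  linarith [ω.betaP_anti (Nat.zero_le i), ω.beta_le_one, ω.betaM_nonneg 0]

theorem betaM_le_one (i : ℕ) : ω.betaM i ≤ 1 := by
  linarith [ω.betaM_anti (Nat.zero_le i), ω.beta_le_one, ω.betaP_nonneg 0]

theorem summable_betaP_mul_one_sub : Summable fun i => ω.betaP i * (1 - ω.betaP i) :=
  ω.summable_betaP.of_nonneg_of_le
    (fun i => mul_nonneg (ω.betaP_nonneg i) (by linarith [ω.betaP_le_one i]))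
    fun i => by nlinarith [ω.betaP_nonneg i]

theorem summable_betaM_mul_one_sub : Summable fun i => ω.betaM i * (1 - ω.betaM i) :=
  ω.summable_betaM.of_nonneg_of_le
    (fun i => mul_nonneg (ω.betaM_nonneg i) (by linarith [ω.betaM_le_one i]))
    fun i => by nlinarith [ω.betaM_nonneg i]

/-- The total decay weight of the factors of `PhiOmega ω`. -/
noncomputable def weight : ℝ :=
  ω.gammaP + ω.gammaM + (∑' i, ω.alphaP i + ∑' i, ω.alphaM i +
    (∑' i, ω.betaP i * (1 - ω.betaP i) + ∑' i, ω.betaM i * (1 - ω.betaM i)))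

/-- The mean frequency `Σ_i β_i⁺ - Σ_i β_i⁻`. -/
noncomputable def meanFreq : ℝ := ∑' i, ω.betaP i - ∑' i, ω.betaM i

theorem hasWeight_PhiOmega :
    HasWeight (fun θ => PhiOmega ω (Complex.exp (θ * Complex.I))) ω.weight ω.meanFreq := by
  have hγ := (hasWeight_exp_mul ω.gammaP_nonneg).mul (hasWeight_exp_mul ω.gammaM_nonneg).comp_neg
  have hP : ∀ i, _ := fun i =>
    (hasWeight_one_add_mul (ω.betaP_nonneg i) (ω.betaP_le_one i)).mul
      (hasWeight_inv_one_sub_mul (ω.alphaP_nonneg i))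
  have hM : ∀ i, _ := fun i =>
    ((hasWeight_one_add_mul (ω.betaM_nonneg i) (ω.betaM_le_one i)).mul
      (hasWeight_inv_one_sub_mul (ω.alphaM_nonneg i))).comp_neg
  have hprod := HasWeight.tprod (fun i => (hP i).mul (hM i)) (fun θ => ?_)
    ((ω.summable_betaP_mul_one_sub.add ω.summable_alphaP).add
      (ω.summable_betaM_mul_one_sub.add ω.summable_alphaM))
    ((ω.summable_betaP.add summable_zero).add (ω.summable_betaM.add summable_zero).neg)
  · have h := hγ.mul hprod
    rw [(ω.summable_betaP_mul_one_sub.add ω.summable_alphaP).tsum_add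
      (ω.summable_betaM_mul_one_sub.add ω.summable_alphaM),
      ω.summable_betaP_mul_one_sub.tsum_add ω.summable_alphaP,
      ω.summable_betaM_mul_one_sub.tsum_add ω.summable_alphaM] at h
    simp only [add_zero, neg_zero, zero_add, ← sub_eq_add_neg] at h
    rw [ω.summable_betaP.tsum_sub ω.summable_betaM] at h
    convert h using 1
    · funext θ
      simp only [PhiOmega, Complex.exp_add, div_eq_mul_inv, ← Complex.exp_neg,
        Complex.ofReal_neg, neg_mul]
    · rw [weight]
      ring
    · rfl
  · simp only [← div_eq_mul_inv]
    exact (multipliable_one_add_mul_div_one_sub_mul ω.alphaP_nonneg ω.betaP_nonneg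
      ω.summable_alphaP_add_betaP θ).mul (multipliable_one_add_mul_div_one_sub_mul
        ω.alphaM_nonneg ω.betaM_nonneg ω.summable_alphaM_add_betaM (-θ))

theorem deltaP_add_deltaM_le : ω.deltaP + ω.deltaM ≤ |ω.meanFreq| + 5 * ω.weight := by
  have hP : ω.deltaP = ω.gammaP + (∑' i, ω.alphaP i + ∑' i, ω.betaP i) := by
    rw [gammaP, ← ω.summable_alphaP.tsum_add ω.summable_betaP]; ring
  have hM : ω.deltaM = ω.gammaM + (∑' i, ω.alphaM i + ∑' i, ω.betaM i) := by
    rw [gammaM, ← ω.summable_alphaM.tsum_add ω.summable_betaM]; ring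
  have h1 := ω.gammaP_nonneg
  have h2 := ω.gammaM_nonneg
  have h3 : 0 ≤ ∑' i, ω.alphaP i := tsum_nonneg ω.alphaP_nonneg
  have h4 : 0 ≤ ∑' i, ω.alphaM i := tsum_nonneg ω.alphaM_nonneg
  have h5 : 0 ≤ ∑' i, ω.betaP i * (1 - ω.betaP i) := tsum_nonneg fun i =>
    mul_nonneg (ω.betaP_nonneg i) (by linarith [ω.betaP_le_one i])
  have h6 : 0 ≤ ∑' i, ω.betaM i * (1 - ω.betaM i) := tsum_nonneg fun i =>
    mul_nonneg (ω.betaM_nonneg i) (by linarith [ω.betaM_le_one i])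
  rw [weight, meanFreq, hP, hM]
  rcases le_total (ω.betaM 0) (1 / 2) with h | h
  · have h7 : ∑' i, ω.betaM i ≤ 2 * ∑' i, ω.betaM i * (1 - ω.betaM i) := by
      rw [← tsum_mul_left]
      refine ω.summable_betaM.tsum_le_tsum (fun i => ?_)
        (ω.summable_betaM_mul_one_sub.mul_left 2)
      nlinarith [ω.betaM_nonneg i, ω.betaM_anti (Nat.zero_le i)]
    linarith [le_abs_self (∑' i, ω.betaP i - ∑' i, ω.betaM i)]
  · have h7 : ∑' i, ω.betaP i ≤ 2 * ∑' i, ω.betaP i * (1 - ω.betaP i) := by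
      rw [← tsum_mul_left]
      refine ω.summable_betaP.tsum_le_tsum (fun i => ?_)
        (ω.summable_betaP_mul_one_sub.mul_left 2)
      nlinarith [ω.betaP_nonneg i, ω.betaP_anti (Nat.zero_le i), ω.beta_le_one]
    linarith [neg_le_abs (∑' i, ω.betaP i - ∑' i, ω.betaM i)]

end OmegaPt

/-- For each fixed `n ∈ ℤ`, the coefficient `φ_n(ω)` tends to `0` as `ω → ∞` in `Ω`,
i.e. as `δ⁺ + δ⁻ → +∞`. -/
theorem stmt2 (n : ℤ) (ε : ℝ) (hε : 0 < ε) :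
    ∃ C : ℝ, 0 < C ∧ ∀ ω : OmegaPt, C ≤ ω.deltaP + ω.deltaM → ‖phiCoef n ω‖ ≤ ε := by
  have hpi := Real.pi_pos
  have hε' : 0 < 2 * π * ε := by positivity
  obtain ⟨d₀, hd₀⟩ := eventually_atTop.1
    (tendsto_integral_inv_sqrt_one_add_mul.eventually_le_const hε')
  set d₁ := max d₀ 0
  have hd₁ : 0 ≤ d₁ := le_max_right _ _
  refine ⟨5 * d₁ + |(n : ℝ)| + π * d₁ / ε + 1, by positivity, fun ω hω => ?_⟩
  have hw := ω.hasWeight_PhiOmega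
  suffices h : ‖∫ θ in (0 : ℝ)..(2 * π), PhiOmega ω (Complex.exp (θ * Complex.I)) *
      Complex.exp (-(n : ℂ) * θ * Complex.I)‖ ≤ 2 * π * ε by
    rw [phiCoef, norm_mul, Complex.norm_real, Real.norm_of_nonneg (by positivity),
      one_div, inv_mul_le_iff₀ Real.two_pi_pos]
    exact h
  rcases le_total d₁ ω.weight with hd | hd
  · exact (hw.norm_integral_mul_exp_le n).trans (hd₀ _ ((le_max_left _ _).trans hd))
  · have hper : Function.Periodic (fun θ : ℝ => PhiOmega ω (Complex.exp (θ * Complex.I)))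
        (2 * π) := by
      intro θ
      simp only [Complex.ofReal_add, Complex.ofReal_mul, Complex.ofReal_ofNat, add_mul,
        Complex.exp_add, Complex.exp_two_pi_mul_I, mul_one]
    have hI := hw.norm_integral_mul_exp_mul_abs_le hper n
    have hm : π * d₁ / ε + 1 ≤ |ω.meanFreq - n| := by
      linarith [ω.deltaP_add_deltaM_le, abs_sub_abs_le_abs_sub ω.meanFreq n]
    have hpos : 0 < |ω.meanFreq - n| := lt_of_lt_of_le (by positivity) hm
    refine le_of_mul_le_mul_right (hI.trans ?_) hpos
    calc 2 * π ^ 2 * ω.weight ≤ 2 * π ^ 2 * d₁ := by gcongr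
      _ = 2 * π * ε * (π * d₁ / ε) := by field_simp
      _ ≤ 2 * π * ε * |ω.meanFreq - n| := by gcongr; linarith
end

section
/- Let E_∞ and E_N (N ≥ 1) be locally compact Hausdorff topological spaces with countable bases, let Λ^{N+1}_N be a Feller Markov kernel from E_{N+1} to E_N and Λ^∞_N a Feller Markov kernel from E_∞ to E_N for each N ≥ 1, satisfying Λ^∞_{N+1} ∘ Λ^{N+1}_N = Λ^∞_N. Assume the map μ ↦ (μΛ^∞_N)_{N≥1} is injective on Borel probability measures on E_∞, i.e. if μ, μ' are Borel probability measures on E_∞ with μΛ^∞_N = μ'Λ^∞_N for all N, then μ = μ'. Then the union over N ≥ 1 of the images {Λ^∞_N f : f ∈ C₀(E_N)} is dense in the Banach space C₀(E_∞) with the supremum norm. -/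
open MeasureTheory ProbabilityTheory
open scoped ZeroAtInfty

/-- A Markov kernel between topological measurable spaces is *Feller* if for every
`f ∈ C₀` of the target, the induced function `x ↦ ∫ f d(K x)` is continuous and
vanishes at infinity. -/
def IsFellerKernel {α β : Type} [TopologicalSpace α] [TopologicalSpace β]
    [MeasurableSpace α] [MeasurableSpace β] (K : Kernel α β) : Prop :=
  ∀ f : C₀(β, ℝ),
    Continuous (fun x => ∫ y, f y ∂(K x)) ∧
      Filter.Tendsto (fun x => ∫ y, f y ∂(K x)) (Filter.cocompact α) (nhds 0)

/-- The inclusion of `C_c(X, ℝ)` in `C₀(X, ℝ)`, as a linear map. -/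
noncomputable def compactlySupportedToZeroAtInfty (X : Type*) [TopologicalSpace X] :
    CompactlySupportedContinuousMap X ℝ →ₗ[ℝ] C₀(X, ℝ) where
  toFun g := ⟨g.toContinuousMap, zero_at_infty g⟩
  map_add' _ _ := rfl
  map_smul' _ _ := rfl

@[simp]
lemma compactlySupportedToZeroAtInfty_apply {X : Type*} [TopologicalSpace X]
    (g : CompactlySupportedContinuousMap X ℝ) (x : X) :
    compactlySupportedToZeroAtInfty X g x = g x := rfl

lemma ZeroAtInftyContinuousMap.abs_apply_le_norm {X : Type*} [TopologicalSpace X]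
    (f : C₀(X, ℝ)) (x : X) : |f x| ≤ ‖f‖ :=
  f.toBCF.norm_coe_le_norm x

lemma ZeroAtInftyContinuousMap.norm_le_of_forall_abs_le {X : Type*} [TopologicalSpace X]
    {f : C₀(X, ℝ)} {C : ℝ} (hC : 0 ≤ C) (h : ∀ x, |f x| ≤ C) : ‖f‖ ≤ C :=
  (BoundedContinuousFunction.norm_le (f := f.toBCF) hC).2 h

lemma ZeroAtInftyContinuousMap.integrable {X : Type*} [TopologicalSpace X] [MeasurableSpace X]
    [OpensMeasurableSpace X] (f : C₀(X, ℝ)) (μ : Measure X) [IsFiniteMeasure μ] :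
    Integrable f μ :=
  f.toBCF.integrable μ

lemma ZeroAtInftyContinuousMap.continuous_integral {X : Type*} [TopologicalSpace X]
    [MeasurableSpace X] [OpensMeasurableSpace X] (μ : Measure X) [IsFiniteMeasure μ] :
    Continuous fun f : C₀(X, ℝ) => ∫ x, f x ∂μ :=
  (LinearMap.mkContinuous (σ := RingHom.id ℝ)
    { toFun := fun f : C₀(X, ℝ) => ∫ x, f x ∂μ
      map_add' := fun f g => integral_add (f.integrable μ) (g.integrable μ)
      map_smul' := fun c f => integral_const_mul c f } (μ.real Set.univ) fun f =>
    (norm_integral_le_of_norm_le_const (.of_forall f.abs_apply_le_norm)).trans_eq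
      (mul_comm _ _)).continuous

/-- Compactly supported functions are dense in `C₀(X, ℝ)`. -/
lemma denseRange_compactlySupportedToZeroAtInfty (X : Type*) [TopologicalSpace X] :
    DenseRange (compactlySupportedToZeroAtInfty X) := by
  refine Metric.denseRange_iff.2 fun f ε hε => ?_
  have hδ : 0 < ε / 2 := half_pos hε
  have hcont : Continuous fun x => f x - max (-(ε / 2)) (min (f x) (ε / 2)) := by
    have := f.continuous
    fun_prop
  have hlim : ∀ᶠ x in Filter.cocompact X, |f x| < ε / 2 := by
    have := (zero_at_infty f).eventually (Metric.ball_mem_nhds (0 : ℝ) hδ)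
    simpa [Real.dist_eq] using this
  obtain ⟨K, hK, hKf⟩ := Filter.mem_cocompact.1 hlim
  have hclosed : IsClosed {x | ε / 2 ≤ |f x|} :=
    isClosed_le continuous_const f.continuous.abs
  have hcompact : IsCompact {x | ε / 2 ≤ |f x|} := by
    refine hK.of_isClosed_subset hclosed fun x hx => ?_
    by_contra hxK
    exact not_lt.2 (show ε / 2 ≤ |f x| from hx) (hKf hxK)
  have hsupp : HasCompactSupport fun x => f x - max (-(ε / 2)) (min (f x) (ε / 2)) := by
    refine hcompact.of_isClosed_subset (isClosed_tsupport _)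
      (closure_minimal (fun x hx => ?_) hclosed)
    by_contra hlt
    have h := abs_lt.1 (not_le.1 (show ¬ ε / 2 ≤ |f x| from hlt))
    exact hx (by simp [min_eq_left h.2.le, max_eq_right h.1.le])
  refine ⟨⟨⟨_, hcont⟩, hsupp⟩, ?_⟩
  rw [dist_eq_norm]
  refine (ZeroAtInftyContinuousMap.norm_le_of_forall_abs_le hδ.le fun x => ?_).trans_lt
    (half_lt_self hε)
  simp only [ZeroAtInftyContinuousMap.sub_apply, compactlySupportedToZeroAtInfty_apply]
  change |f x - (f x - max (-(ε / 2)) (min (f x) (ε / 2)))| ≤ ε / 2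
  rw [sub_sub_cancel, abs_le]
  exact ⟨le_max_left _ _, max_le (by linarith) (min_le_right _ _)⟩

/-- A continuous linear functional on `C₀(X, ℝ)` is a difference of two positive bounded ones. -/
lemma exists_nonneg_sub_nonneg_of_dual {X : Type*} [TopologicalSpace X]
    (φ : C₀(X, ℝ) →L[ℝ] ℝ) :
    ∃ p q : C₀(X, ℝ) →ₗ[ℝ] ℝ,
      (∀ f, (∀ x, 0 ≤ f x) → 0 ≤ p f) ∧ (∀ f, (∀ x, 0 ≤ f x) → 0 ≤ q f) ∧
      (∀ f, p f ≤ ‖φ‖ * ‖f‖) ∧ (∀ f, q f ≤ ‖φ‖ * ‖f‖) ∧ ∀ f, φ f = p f - q f := by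
  have hφ0 : 0 ≤ ‖φ‖ := norm_nonneg φ
  let P : C₀(X, ℝ) × C₀(X, ℝ) → BoundedContinuousFunction X ℝ := fun w =>
    w.1.toBCF ⊔ 0 + w.2.toBCF ⊔ 0
  have hP (w : C₀(X, ℝ) × C₀(X, ℝ)) (x : X) : P w x = max (w.1 x) 0 + max (w.2 x) 0 := rfl
  have hP0 (w : C₀(X, ℝ) × C₀(X, ℝ)) (x : X) : 0 ≤ P w x := by rw [hP]; positivity
  have hPle (w : C₀(X, ℝ) × C₀(X, ℝ)) {C : ℝ} (hC : 0 ≤ C) (h : ∀ x, P w x ≤ C) : ‖P w‖ ≤ C :=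
    (BoundedContinuousFunction.norm_le hC).2 fun x => by
      rw [Real.norm_of_nonneg (hP0 w x)]; exact h x
  have hPapply (w : C₀(X, ℝ) × C₀(X, ℝ)) (x : X) : P w x ≤ ‖P w‖ :=
    (le_abs_self _).trans ((P w).norm_coe_le_norm x)
  let S : Submodule ℝ (C₀(X, ℝ) × C₀(X, ℝ)) :=
    LinearMap.range (LinearMap.prod LinearMap.id (-LinearMap.id))
  let F : (C₀(X, ℝ) × C₀(X, ℝ)) →ₗ.[ℝ] ℝ :=
    ⟨S, (φ.toLinearMap ∘ₗ LinearMap.fst ℝ C₀(X, ℝ) C₀(X, ℝ)).domRestrict S⟩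
  obtain ⟨ψ, hψF, hψ⟩ := exists_extension_of_le_sublinear F (fun w => ‖φ‖ * ‖P w‖)
    (by
      intro c hc w
      have : P (c • w) = c • P w := by
        ext x
        simp only [hP, BoundedContinuousFunction.coe_smul, smul_eq_mul, mul_add,
          mul_max_of_nonneg _ _ hc.le, mul_zero]
        rfl
      simp only [this, norm_smul, Real.norm_of_nonneg hc.le]
      ring)
    (by
      intro v w
      rw [← mul_add]
      refine mul_le_mul_of_nonneg_left (hPle _ (by positivity) fun x => ?_) hφ0
      refine le_trans ?_ (add_le_add (hPapply v x) (hPapply w x))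
      simp only [hP, Prod.fst_add, Prod.snd_add, ZeroAtInftyContinuousMap.add_apply]
      have h1 := max_add_add_le_max_add_max (a := v.1 x) (b := w.1 x) (c := 0) (d := 0)
      have h2 := max_add_add_le_max_add_max (a := v.2 x) (b := w.2 x) (c := 0) (d := 0)
      rw [add_zero] at h1 h2
      linarith)
    (by
      rintro ⟨w, f, rfl⟩
      change φ f ≤ ‖φ‖ * ‖P (f, -f)‖
      refine (le_abs_self _).trans ((φ.le_opNorm f).trans ?_)
      refine mul_le_mul_of_nonneg_left ?_ hφ0
      refine ZeroAtInftyContinuousMap.norm_le_of_forall_abs_le (norm_nonneg _) fun x => ?_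
      refine le_trans ?_ (hPapply _ x)
      rw [hP, ZeroAtInftyContinuousMap.neg_apply]
      exact abs_le'.2 ⟨by linarith [le_max_left (f x) 0, le_max_right (-f x) 0],
        by linarith [le_max_right (f x) 0, le_max_left (-f x) 0]⟩)
  have hneg {w : C₀(X, ℝ) × C₀(X, ℝ)} (h1 : ∀ x, w.1 x ≤ 0) (h2 : ∀ x, w.2 x ≤ 0) : ψ w ≤ 0 := by
    have : ‖P w‖ ≤ 0 := hPle w le_rfl fun x => by
      rw [hP, max_eq_right (h1 x), max_eq_right (h2 x), add_zero]
    have h0 := le_antisymm this (norm_nonneg _)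
    simpa [h0] using hψ w
  have hb {w : C₀(X, ℝ) × C₀(X, ℝ)} {C : ℝ} (hC : 0 ≤ C) (h : ∀ x, P w x ≤ C) : ψ w ≤ ‖φ‖ * C :=
    (hψ w).trans (mul_le_mul_of_nonneg_left (hPle w hC h) hφ0)
  refine ⟨ψ ∘ₗ LinearMap.inl ℝ C₀(X, ℝ) C₀(X, ℝ), ψ ∘ₗ LinearMap.inr ℝ C₀(X, ℝ) C₀(X, ℝ),
    fun f hf => ?_, fun f hf => ?_,
    fun f => hb (norm_nonneg f) fun x => ?_, fun f => hb (norm_nonneg f) fun x => ?_, fun f => ?_⟩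
  · rw [← neg_nonpos, ← map_neg]
    exact hneg (by simpa using hf) (by simp)
  · rw [← neg_nonpos, ← map_neg]
    exact hneg (by simp) (by simpa using hf)
  · rw [hP]
    simpa using (le_abs_self _).trans (f.abs_apply_le_norm x)
  · rw [hP]
    simpa using (le_abs_self _).trans (f.abs_apply_le_norm x)
  · have h := hψF ⟨(f, -f), f, rfl⟩
    change ψ (f, -f) = φ f at h
    rw [← h, LinearMap.comp_apply, LinearMap.comp_apply, ← map_sub]
    simp

/-- The **Riesz–Markov–Kakutani theorem** for bounded positive functionals on `C₀(X, ℝ)`. -/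
lemma exists_isFiniteMeasure_integral_eq {X : Type*} [TopologicalSpace X] [T2Space X]
    [LocallyCompactSpace X] [MeasurableSpace X] [BorelSpace X]
    (p : C₀(X, ℝ) →ₗ[ℝ] ℝ) (hp : ∀ f, (∀ x, 0 ≤ f x) → 0 ≤ p f) {C : ℝ}
    (hC : ∀ f, p f ≤ C * ‖f‖) :
    ∃ μ : Measure X, IsFiniteMeasure μ ∧ ∀ f : C₀(X, ℝ), ∫ x, f x ∂μ = p f := by
  let Λ : CompactlySupportedContinuousMap X ℝ →ₚ[ℝ] ℝ :=
    PositiveLinearMap.mk₀ (p ∘ₗ compactlySupportedToZeroAtInfty X) fun g hg => hp _ hg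
  have hΛ (g) : Λ g = p (compactlySupportedToZeroAtInfty X g) := rfl
  have hK {K : Set X} (hK : IsCompact K) :
      RealRMK.rieszMeasure Λ K ≤ ENNReal.ofReal |C| := by
    obtain ⟨f, hf1, -, hfc, hf01⟩ :=
      exists_continuous_one_zero_of_isCompact hK isClosed_empty (Set.disjoint_empty K)
    refine (RealRMK.rieszMeasure_le_of_eq_one Λ (f := ⟨f, hfc⟩) (fun x => (hf01 x).1) hK
      fun x hx => hf1 hx).trans (ENNReal.ofReal_le_ofReal ?_)
    rw [hΛ]
    refine (hC _).trans ((mul_le_mul_of_nonneg_right (le_abs_self C) (norm_nonneg _)).trans ?_)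
    refine mul_le_of_le_one_right (abs_nonneg C)
      (ZeroAtInftyContinuousMap.norm_le_of_forall_abs_le zero_le_one fun x => ?_)
    exact abs_le.2 ⟨neg_one_lt_zero.le.trans (hf01 x).1, (hf01 x).2⟩
  have hreg : (RealRMK.rieszMeasure Λ).Regular := inferInstance
  have hfin : IsFiniteMeasure (RealRMK.rieszMeasure Λ) := by
    refine ⟨lt_of_le_of_lt ?_ (ENNReal.ofReal_lt_top (r := |C|))⟩
    rw [isOpen_univ.measure_eq_iSup_isCompact]
    exact iSup₂_le fun K _ => iSup_le hK
  refine ⟨RealRMK.rieszMeasure Λ, hfin, fun f => ?_⟩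
  have hpc : Continuous p :=
    (p.mkContinuous C fun f => abs_le'.2 ⟨hC f, by simpa using hC (-f)⟩).continuous
  refine congrFun ((denseRange_compactlySupportedToZeroAtInfty X).equalizer
    (ZeroAtInftyContinuousMap.continuous_integral _) hpc ?_) f
  ext g
  exact RealRMK.integral_rieszMeasure Λ g

/-- Finite measures on a second countable locally compact Hausdorff space are determined by
the integrals of functions in `C₀`. -/
lemma MeasureTheory.Measure.ext_of_integral_eq_zeroAtInfty {X : Type*} [TopologicalSpace X]
    [T2Space X] [LocallyCompactSpace X] [SecondCountableTopology X] [MeasurableSpace X]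
    [BorelSpace X] {μ ν : Measure X} [IsFiniteMeasure μ] [IsFiniteMeasure ν]
    (h : ∀ f : C₀(X, ℝ), ∫ x, f x ∂μ = ∫ x, f x ∂ν) : μ = ν :=
  Measure.ext_of_integral_eq_on_compactlySupported fun g =>
    h (compactlySupportedToZeroAtInfty X g)

/-- A submodule on which only the zero continuous functional vanishes is dense. -/
lemma Submodule.dense_of_forall_dual_eq_zero {V : Type*} [NormedAddCommGroup V] [NormedSpace ℝ V]
    (S : Submodule ℝ V) (h : ∀ φ : V →L[ℝ] ℝ, (∀ v ∈ S, φ v = 0) → φ = 0) :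
    Dense (S : Set V) := by
  intro v
  by_contra hv
  obtain ⟨φ, u, hφ, hu⟩ := geometric_hahn_banach_closed_point S.convex.closure isClosed_closure hv
  have h0 : 0 < u := by simpa using hφ 0 (subset_closure S.zero_mem)
  have hS (w) (hw : w ∈ S) : φ w = 0 := by
    by_contra hne
    have := hφ ((u / φ w) • w) (subset_closure (S.smul_mem _ hw))
    rw [map_smul, smul_eq_mul, div_mul_cancel₀ _ hne] at this
    exact lt_irrefl _ this
  rw [h φ hS] at hu
  exact lt_asymm h0 hu

/-- The operator `C₀(β, ℝ) → C₀(α, ℝ)` induced by a Feller Markov kernel. -/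
noncomputable def IsFellerKernel.toLinearMap {α β : Type} [TopologicalSpace α] [TopologicalSpace β]
    [MeasurableSpace α] [MeasurableSpace β] [OpensMeasurableSpace β] {K : Kernel α β}
    [IsMarkovKernel K] (hK : IsFellerKernel K) : C₀(β, ℝ) →ₗ[ℝ] C₀(α, ℝ) where
  toFun f := ⟨⟨fun x => ∫ y, f y ∂(K x), (hK f).1⟩, (hK f).2⟩
  map_add' f g := by
    ext x
    exact integral_add (f.integrable _) (g.integrable _)
  map_smul' c f := by
    ext x
    exact integral_const_mul c _

lemma IsFellerKernel.toLinearMap_apply {α β : Type} [TopologicalSpace α] [TopologicalSpace β]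
    [MeasurableSpace α] [MeasurableSpace β] [OpensMeasurableSpace β] {K : Kernel α β}
    [IsMarkovKernel K] (hK : IsFellerKernel K) (f : C₀(β, ℝ)) (x : α) :
    hK.toLinearMap f x = ∫ y, f y ∂(K x) := rfl

lemma MeasureTheory.Measure.integral_bind_kernel {α β : Type*} [MeasurableSpace α]
    [MeasurableSpace β] {μ : Measure α} {K : Kernel α β} {f : β → ℝ}
    (hf : Integrable f (μ.bind K)) : ∫ y, f y ∂(μ.bind K) = ∫ x, ∫ y, f y ∂(K x) ∂μ :=
  Kernel.integral_comp (κ := Kernel.const Unit μ) (η := K) (a := ()) hf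

/-- If Markov kernels separate probability measures, they separate finite measures. -/
lemma eq_of_forall_bind_eq {ι α : Type*} {β : ι → Type*} [Nonempty ι] [MeasurableSpace α]
    [∀ i, MeasurableSpace (β i)] (K : ∀ i, Kernel α (β i)) [∀ i, IsMarkovKernel (K i)]
    (hinj : ∀ μ μ' : Measure α, IsProbabilityMeasure μ → IsProbabilityMeasure μ' →
      (∀ i, μ.bind (K i) = μ'.bind (K i)) → μ = μ')
    {μ ν : Measure α} [IsFiniteMeasure μ] [IsFiniteMeasure ν]
    (h : ∀ i, μ.bind (K i) = ν.bind (K i)) : μ = ν := by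
  have hmass : μ Set.univ = ν Set.univ := by
    obtain ⟨i⟩ := ‹Nonempty ι›
    simpa only [Measure.comp_apply_univ] using congrArg (fun ρ => ρ Set.univ) (h i)
  rcases eq_or_ne (μ Set.univ) 0 with h0 | h0
  · rw [Measure.measure_univ_eq_zero.1 h0, Measure.measure_univ_eq_zero.1 (hmass.symm.trans h0)]
  have htop := measure_ne_top μ Set.univ
  have key := hinj ((μ Set.univ)⁻¹ • μ) ((μ Set.univ)⁻¹ • ν)
    ⟨by simp [ENNReal.inv_mul_cancel h0 htop]⟩
    ⟨by simp [← hmass, ENNReal.inv_mul_cancel h0 htop]⟩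
    fun i => by rw [Measure.comp_smul, Measure.comp_smul, h i]
  have := congrArg (fun ρ => μ Set.univ • ρ) key
  simpa [smul_smul, ENNReal.mul_inv_cancel h0 htop] using this

/-- Lemma 1.3 of Borodin–Olshanski: if `E_∞` is a Feller boundary of the chain
`(E_N)` (links are Feller Markov kernels, the compatibility relations hold and the map
`μ ↦ (μΛ^∞_N)` is injective on probability measures), then the union of the images of the
maps `C₀(E_N) → C₀(E_∞)` induced by the links `Λ^∞_N` is dense in `C₀(E_∞)`. -/
theorem stmt3
    (E : ℕ → Type) (Einf : Type)
    [∀ N, TopologicalSpace (E N)] [∀ N, T2Space (E N)] [∀ N, LocallyCompactSpace (E N)]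
    [∀ N, SecondCountableTopology (E N)] [∀ N, MeasurableSpace (E N)] [∀ N, BorelSpace (E N)]
    [TopologicalSpace Einf] [T2Space Einf] [LocallyCompactSpace Einf]
    [SecondCountableTopology Einf] [MeasurableSpace Einf] [BorelSpace Einf]
    (Lk : ∀ N : ℕ, Kernel (E (N + 1)) (E N)) (Linf : ∀ N : ℕ, Kernel Einf (E N))
    [∀ N, IsMarkovKernel (Lk N)] [∀ N, IsMarkovKernel (Linf N)]
    (hLkFeller : ∀ N, IsFellerKernel (Lk N)) (hLinfFeller : ∀ N, IsFellerKernel (Linf N))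
    (hcomm : ∀ N, (Lk N) ∘ₖ (Linf (N + 1)) = Linf N)
    (hinj : ∀ μ μ' : Measure Einf, IsProbabilityMeasure μ → IsProbabilityMeasure μ' →
      (∀ N, μ.bind (Linf N) = μ'.bind (Linf N)) → μ = μ') :
    Dense {g : C₀(Einf, ℝ) | ∃ (N : ℕ) (f : C₀(E N, ℝ)),
      ∀ x : Einf, g x = ∫ y, f y ∂((Linf N) x)} := by
  have hstep (N : ℕ) : LinearMap.range (hLinfFeller N).toLinearMap ≤
      LinearMap.range (hLinfFeller (N + 1)).toLinearMap := by
    rintro _ ⟨f, rfl⟩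
    refine ⟨(hLkFeller N).toLinearMap f, ?_⟩
    ext x
    simp only [IsFellerKernel.toLinearMap_apply]
    rw [← hcomm N, Kernel.integral_comp (f.integrable _)]
  have hmono : Monotone fun N => LinearMap.range (hLinfFeller N).toLinearMap :=
    monotone_nat_of_le_succ hstep
  have hset : {g : C₀(Einf, ℝ) | ∃ (N : ℕ) (f : C₀(E N, ℝ)),
      ∀ x : Einf, g x = ∫ y, f y ∂((Linf N) x)} =
      ((⨆ N, LinearMap.range (hLinfFeller N).toLinearMap : Submodule ℝ C₀(Einf, ℝ)) :
        Set C₀(Einf, ℝ)) := by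
    ext g
    rw [SetLike.mem_coe, Submodule.mem_iSup_of_directed _ hmono.directed_le]
    refine exists_congr fun N => exists_congr fun f => ?_
    rw [eq_comm, DFunLike.ext_iff]
    rfl
  rw [hset]
  refine Submodule.dense_of_forall_dual_eq_zero _ fun φ hφ => ?_
  obtain ⟨p, q, hp, hq, hpC, hqC, hpq⟩ := exists_nonneg_sub_nonneg_of_dual φ
  obtain ⟨μ, _, hμ⟩ := exists_isFiniteMeasure_integral_eq p hp hpC
  obtain ⟨ν, _, hν⟩ := exists_isFiniteMeasure_integral_eq q hq hqC
  have hμν : μ = ν := by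
    refine eq_of_forall_bind_eq Linf hinj fun N =>
      Measure.ext_of_integral_eq_zeroAtInfty fun f => ?_
    rw [Measure.integral_bind_kernel (f.integrable _),
      Measure.integral_bind_kernel (f.integrable _)]
    have h0 := hφ _ (Submodule.mem_iSup_of_mem N ⟨f, rfl⟩)
    rw [hpq, ← hμ, ← hν] at h0
    exact sub_eq_zero.1 h0
  ext f
  rw [hpq, ← hμ, ← hν, hμν, sub_self]
  rfl
end

section
/- Let E_∞ and E_N (N ≥ 1) be measurable spaces, Λ^{N+1}_N a Markov kernel from E_{N+1} to E_N and Λ^∞_N a Markov kernel from E_∞ to E_N for each N, with Λ^∞_{N+1} ∘ Λ^{N+1}_N = Λ^∞_N. Assume the map μ ↦ (μΛ^∞_N)_{N≥1} is injective on probability measures on E_∞. For each N let (P_N(t))_{t≥0} be a family of Markov kernels from E_N to E_N satisfying the semigroup law P_N(s) ∘ P_N(t) = P_N(s+t) and the compatibility P_{N+1}(t) ∘ Λ^{N+1}_N = Λ^{N+1}_N ∘ P_N(t) for all s,t ≥ 0 and N ≥ 1. Then: (a) there is at most one family (P(t))_{t≥0} of Markov kernels from E_∞ to E_∞ satisfying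 P(t) ∘ Λ^∞_N = Λ^∞_N ∘ P_N(t) for all t ≥ 0 and N ≥ 1; and (b) any family (P(t))_{t≥0} satisfying these relations automatically satisfies the Chapman–Kolmogorov equation P(s) ∘ P(t) = P(s+t) for all s,t ≥ 0. -/
open MeasureTheory ProbabilityTheory
open scoped NNReal

/-- A family of kernels that separates probability measures is jointly left cancellable for
Markov kernels. -/
theorem kernel_eq_of_forall_comp_eq {ι X Y : Type*} {F : ι → Type*}
    [MeasurableSpace X] [MeasurableSpace Y] [∀ i, MeasurableSpace (F i)]
    {L : ∀ i, Kernel Y (F i)}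
    (hL : ∀ μ μ' : Measure Y, IsProbabilityMeasure μ → IsProbabilityMeasure μ' →
      (∀ i, μ.bind (L i) = μ'.bind (L i)) → μ = μ')
    (K K' : Kernel X Y) [IsMarkovKernel K] [IsMarkovKernel K']
    (h : ∀ i, L i ∘ₖ K = L i ∘ₖ K') : K = K' := by
  ext1 x
  refine hL _ _ inferInstance inferInstance fun i => ?_
  rw [← Kernel.comp_apply, ← Kernel.comp_apply, h]

/-- Proposition 1.4 of Borodin–Olshanski (uniqueness part and Chapman–Kolmogorov):
given a projective chain of measurable spaces `(E_N)` with Markov links `Λ^{N+1}_N`,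
kernels `Λ^∞_N` from a space `E_∞` satisfying `Λ^∞_{N+1} ∘ Λ^{N+1}_N = Λ^∞_N`, such that
`μ ↦ (μΛ^∞_N)_N` is injective on probability measures, and compatible Markov semigroups
`(P_N(t))` on the `E_N`, then (a) there is at most one family `(P(t))` of Markov kernels on
`E_∞` with `P(t) ∘ Λ^∞_N = Λ^∞_N ∘ P_N(t)`, and (b) any such family satisfies the
Chapman–Kolmogorov equation `P(s) ∘ P(t) = P(s+t)`.
(Here `K ∘ L` denotes "first `K`, then `L`", i.e. Mathlib's `L ∘ₖ K`.) -/
theorem stmt4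
    (E : ℕ → Type) (Einf : Type)
    [∀ N, MeasurableSpace (E N)] [MeasurableSpace Einf]
    (Lk : ∀ N : ℕ, Kernel (E (N + 1)) (E N)) (Linf : ∀ N : ℕ, Kernel Einf (E N))
    [∀ N, IsMarkovKernel (Lk N)] [∀ N, IsMarkovKernel (Linf N)]
    (hcomm : ∀ N, (Lk N) ∘ₖ (Linf (N + 1)) = Linf N)
    (hinj : ∀ μ μ' : Measure Einf, IsProbabilityMeasure μ → IsProbabilityMeasure μ' →
      (∀ N, μ.bind (Linf N) = μ'.bind (Linf N)) → μ = μ')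
    (Pl : ∀ N : ℕ, ℝ≥0 → Kernel (E N) (E N))
    [∀ N t, IsMarkovKernel (Pl N t)]
    (hsemi : ∀ N (s t : ℝ≥0), (Pl N t) ∘ₖ (Pl N s) = Pl N (s + t))
    (hcompat : ∀ N (t : ℝ≥0), (Lk N) ∘ₖ (Pl (N + 1) t) = (Pl N t) ∘ₖ (Lk N)) :
    (∀ P P' : ℝ≥0 → Kernel Einf Einf,
        (∀ t, IsMarkovKernel (P t)) → (∀ t, IsMarkovKernel (P' t)) →
        (∀ N t, (Linf N) ∘ₖ (P t) = (Pl N t) ∘ₖ (Linf N)) →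
        (∀ N t, (Linf N) ∘ₖ (P' t) = (Pl N t) ∘ₖ (Linf N)) →
        ∀ t, P t = P' t) ∧
    (∀ P : ℝ≥0 → Kernel Einf Einf,
        (∀ t, IsMarkovKernel (P t)) →
        (∀ N t, (Linf N) ∘ₖ (P t) = (Pl N t) ∘ₖ (Linf N)) →
        ∀ s t : ℝ≥0, (P t) ∘ₖ (P s) = P (s + t)) := by
  refine ⟨fun P P' hP hP' h h' t => ?_, fun P hP h s t => ?_⟩
  · exact kernel_eq_of_forall_comp_eq hinj _ _ fun N => (h N t).trans (h' N t).symm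
  · refine kernel_eq_of_forall_comp_eq hinj _ _ fun N => ?_
    rw [← Kernel.comp_assoc, h, Kernel.comp_assoc, h, ← Kernel.comp_assoc, hsemi, h]
end

section
/- Let E_∞ and E_N (N ≥ 1) be measurable spaces, Λ^{N+1}_N and Λ^∞_N Markov kernels as before with Λ^∞_{N+1} ∘ Λ^{N+1}_N = Λ^∞_N, and assume μ ↦ (μΛ^∞_N)_{N≥1} is injective on probability measures on E_∞. Let (P_N(t))_{t≥0} be Markov kernels on E_N and (P(t))_{t≥0} Markov kernels on E_∞ with P(t) ∘ Λ^∞_N = Λ^∞_N ∘ P_N(t) for all t ≥ 0 and N ≥ 1. Suppose μ_N is a probability measure on E_N with μ_N P_N(t) = μ_N for all t ≥ 0 and μ_{N+1} Λ^{N+1}_N = μ_N for all N, and suppose μ is a probability measure on E_∞ with μΛ^∞_N = μ_N for all N. Then μ P(t) = μ for all t ≥ 0. If, moreover, for every N the measure μ_N is the unique probability measure on E_N invariant under all P_N(t), then μ is the unique probability measure on E_∞ invariant under all P(t). -/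
open MeasureTheory ProbabilityTheory
open scoped NNReal

/-- If `L` intertwines the kernels `P` and `Q`, pushing forward along `L` exchanges their
actions on measures. -/
lemma bind_bind_of_comp_eq_comp {α β : Type*} [MeasurableSpace α] [MeasurableSpace β]
    {L : Kernel α β} {P : Kernel α α} {Q : Kernel β β} (h : L ∘ₖ P = Q ∘ₖ L) (ν : Measure α) :
    (ν.bind P).bind L = (ν.bind L).bind Q := by
  rw [Measure.comp_assoc, Measure.comp_assoc, h]

/-- Invariant measures (Subsection 2.8 of Borodin–Olshanski): in the projective chain
setting with compatible semigroups, if `μ_N` is invariant for `(P_N(t))`, the `μ_N` are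
compatible with the links, and `μ` is the probability measure on the boundary with
`μΛ^∞_N = μ_N`, then `μ` is invariant for `(P(t))`; moreover, if each `μ_N` is the unique
invariant probability measure for `(P_N(t))`, then `μ` is the unique invariant probability
measure for `(P(t))`. -/
theorem stmt6
    (E : ℕ → Type) (Einf : Type)
    [∀ N, MeasurableSpace (E N)] [MeasurableSpace Einf]
    (Lk : ∀ N : ℕ, Kernel (E (N + 1)) (E N)) (Linf : ∀ N : ℕ, Kernel Einf (E N))
    [∀ N, IsMarkovKernel (Lk N)] [∀ N, IsMarkovKernel (Linf N)]
    (hcomm : ∀ N, (Lk N) ∘ₖ (Linf (N + 1)) = Linf N)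
    (hinj : ∀ μ μ' : Measure Einf, IsProbabilityMeasure μ → IsProbabilityMeasure μ' →
      (∀ N, μ.bind (Linf N) = μ'.bind (Linf N)) → μ = μ')
    (Pl : ∀ N : ℕ, ℝ≥0 → Kernel (E N) (E N))
    [∀ N t, IsMarkovKernel (Pl N t)]
    (P : ℝ≥0 → Kernel Einf Einf)
    [∀ t, IsMarkovKernel (P t)]
    (hPcompat : ∀ N (t : ℝ≥0), (Linf N) ∘ₖ (P t) = (Pl N t) ∘ₖ (Linf N))
    (μl : ∀ N : ℕ, Measure (E N))
    [∀ N, IsProbabilityMeasure (μl N)]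
    (hinv : ∀ N (t : ℝ≥0), (μl N).bind (Pl N t) = μl N)
    (hconsist : ∀ N, (μl (N + 1)).bind (Lk N) = μl N)
    (μ : Measure Einf) [IsProbabilityMeasure μ]
    (hμ : ∀ N, μ.bind (Linf N) = μl N) :
    (∀ t : ℝ≥0, μ.bind (P t) = μ) ∧
    ((∀ N, ∀ ν : Measure (E N), IsProbabilityMeasure ν →
        (∀ t : ℝ≥0, ν.bind (Pl N t) = ν) → ν = μl N) →
      ∀ ν : Measure Einf, IsProbabilityMeasure ν →
        (∀ t : ℝ≥0, ν.bind (P t) = ν) → ν = μ) := by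
  refine ⟨fun t ↦ hinj _ _ inferInstance inferInstance fun N ↦ ?_,
    fun huniq ν hν hνP ↦ hinj _ _ hν inferInstance fun N ↦ ?_⟩
  · rw [bind_bind_of_comp_eq_comp (hPcompat N t), hμ, hinv]
  · rw [hμ]
    refine huniq N _ inferInstance fun t ↦ ?_
    rw [← bind_bind_of_comp_eq_comp (hPcompat N t), hνP]
end

section
/- Let u, u', v, v' ∈ ℂ, and for N ≥ 1 let d_N = N(N−1)(N−2)/3 − (u+u'+v+v')·N(N−1)/2. For 1 ≤ j ≤ N let 𝒟_j act on functions F : ℤ^N → ℂ by (𝒟_j F)(x) = (x_j−u)(x_j−u')·(F(x + e_j) − F(x)) + (x_j+v)(x_j+v')·(F(x − e_j) − F(x)), where e_j is the j-th standard basis vector. Then (𝒟_1 + ⋯ + 𝒟_N) V_N = d_N · V_N as functions on ℤ^N, where V_N(x_1,…,x_N) = ∏_{1≤i<j≤N}(x_i − x_j) is the Vandermonde product. -/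
/-- The Vandermonde product `∏_{i<j} (x_i − x_j)` (as a complex number). -/
def Vc {N : ℕ} (x : Fin N → ℤ) : ℂ :=
  ∏ i : Fin N, ∏ j : Fin N, if i < j then ((x i : ℂ) - (x j : ℂ)) else 1

/-- The constant `d_N = N(N−1)(N−2)/3 − (u+u'+v+v')·N(N−1)/2`. -/
noncomputable def dConst (u u' v v' : ℂ) (N : ℕ) : ℂ :=
  (N : ℂ) * ((N : ℂ) - 1) * ((N : ℂ) - 2) / 3 -
    (u + u' + v + v') * ((N : ℂ) * ((N : ℂ) - 1)) / 2

open Polynomial in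
/-- Degree bounds and leading coefficients of the image `T` of `Xⁿ` under the difference operator
with coefficients `a = (X - u)(X - u')` and `b = (X + v)(X + v')`, and of the polynomials
`a (X + 1)ⁿ ± b (X - 1)ⁿ`, which govern the passage from `n` to `n + 1`. -/
lemma differenceOperator_X_pow (u u' v v' : ℂ) (n : ℕ) :
    let a : ℂ[X] := (X - C u) * (X - C u')
    let b : ℂ[X] := (X + C v) * (X + C v')
    let T : ℂ[X] := a * ((X + 1) ^ n - X ^ n) + b * ((X - 1) ^ n - X ^ n)
    let S : ℂ[X] := a * (X + 1) ^ n - b * (X - 1) ^ n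
    let R : ℂ[X] := a * (X + 1) ^ n + b * (X - 1) ^ n
    (T.natDegree ≤ n ∧ T.coeff n = n * (n - 1) - (u + u' + v + v') * n) ∧
    (S.natDegree ≤ n + 1 ∧ S.coeff (n + 1) = 2 * n - (u + u' + v + v')) ∧
    (R.natDegree ≤ n + 2 ∧ R.coeff (n + 2) = 2) := by
  intro a b
  induction n with
  | zero =>
    have hS : a - b = C (-(u + u' + v + v')) * X + C (u * u' - v * v') := by
      simp only [a, b, C_add, C_sub, C_neg, C_mul]; ring
    have hR : a + b = C 2 * X ^ 2 + C (v + v' - u - u') * X + C (u * u' + v * v') := by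
      have h2 : (C 2 : ℂ[X]) = 2 := rfl
      simp only [a, b, C_add, C_sub, C_mul, h2]; ring
    refine ⟨by simp, ?_, ?_⟩
    · simp only [pow_zero, mul_one, hS]
      exact ⟨natDegree_linear_le, by simp [coeff_C]⟩
    · simp only [pow_zero, mul_one, hR]
      exact ⟨natDegree_quadratic_le, by simp⟩
  | succ n ih =>
    intro T S R
    obtain ⟨⟨hT, hT'⟩, ⟨hS, hS'⟩, hR, hR'⟩ := ih
    have eT : T = X * (a * ((X + 1) ^ n - X ^ n) + b * ((X - 1) ^ n - X ^ n)) +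
        (a * (X + 1) ^ n - b * (X - 1) ^ n) := by simp only [T]; ring
    have eS : S = X * (a * (X + 1) ^ n - b * (X - 1) ^ n) +
        (a * (X + 1) ^ n + b * (X - 1) ^ n) := by simp only [S]; ring
    have eR : R = X * (a * (X + 1) ^ n + b * (X - 1) ^ n) +
        (a * (X + 1) ^ n - b * (X - 1) ^ n) := by simp only [R]; ring
    have hX : ∀ {p : ℂ[X]} {m : ℕ}, p.natDegree ≤ m → (X * p).natDegree ≤ m + 1 := by
      intro p m h
      refine natDegree_mul_le.trans ?_
      rw [natDegree_X]; omega
    refine ⟨⟨?_, ?_⟩, ⟨?_, ?_⟩, ?_, ?_⟩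
    · rw [eT]; exact natDegree_add_le_of_degree_le (hX hT) hS
    · rw [eT, coeff_add, coeff_X_mul, hT', hS']; push_cast; ring
    · rw [eS]; exact natDegree_add_le_of_degree_le (hX hS) hR
    · rw [eS, coeff_add, coeff_X_mul, hS', hR']; push_cast; ring
    · rw [eR]; exact natDegree_add_le_of_degree_le (hX hR) (hS.trans (by omega))
    · rw [eR, coeff_add, coeff_X_mul, hR',
        coeff_eq_zero_of_natDegree_lt (lt_of_le_of_lt hS (by omega)), add_zero]

/-- Replacing the rows of `M` one at a time by those of `M * A` and summing the determinants
multiplies `M.det` by the trace of `A`. -/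
lemma Matrix.sum_det_updateRow_mul {ι R : Type*} [Fintype ι] [DecidableEq ι] [CommRing R]
    (M A : Matrix ι ι R) :
    ∑ j, (M.updateRow j ((M * A) j)).det = A.trace * M.det := by
  calc ∑ j, (M.updateRow j ((M * A) j)).det
      = ((M * A) * M.adjugate).trace := by
        refine Finset.sum_congr rfl fun j _ => ?_
        rw [← Matrix.cramer_transpose_apply, Matrix.cramer_eq_adjugate_mulVec,
          ← Matrix.adjugate_transpose, Matrix.mulVec_transpose]
        rfl
    _ = A.trace * M.det := by
        rw [Matrix.trace_mul_comm, ← Matrix.mul_assoc, Matrix.adjugate_mul, Matrix.smul_mul,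
          Matrix.one_mul, Matrix.trace_smul, smul_eq_mul, mul_comm]

lemma Vc_eq_mul_det_vandermonde {N : ℕ} (x : Fin N → ℤ) :
    Vc x = (∏ i : Fin N, ∏ _j ∈ Finset.Ioi i, (-1 : ℂ)) *
      (Matrix.vandermonde fun i => (x i : ℂ)).det := by
  rw [Matrix.det_vandermonde, ← Finset.prod_mul_distrib]
  refine Finset.prod_congr rfl fun i _ => ?_
  rw [← Finset.prod_mul_distrib, ← Finset.prod_filter]
  refine Finset.prod_congr (by ext; simp) fun j _ => by ring

lemma vandermonde_update {N : ℕ} (x : Fin N → ℤ) (j : Fin N) (y : ℤ) :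
    (Matrix.vandermonde fun i => ((Function.update x j y i : ℤ) : ℂ)) =
      (Matrix.vandermonde fun i => (x i : ℂ)).updateRow j fun k => (y : ℂ) ^ (k : ℕ) := by
  ext i k
  rcases eq_or_ne i j with rfl | h
  · simp [Matrix.vandermonde_apply]
  · simp [Matrix.vandermonde_apply, h]

lemma dConst_eq_sum (u u' v v' : ℂ) (N : ℕ) :
    dConst u u' v v' N =
      ∑ j : Fin N, ((j : ℂ) * ((j : ℂ) - 1) - (u + u' + v + v') * (j : ℂ)) := by
  induction N with
  | zero => simp [dConst]
  | succ n ih =>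
    rw [Fin.sum_univ_castSucc]
    simp only [Fin.val_castSucc, Fin.val_last, ← ih, dConst]
    push_cast
    ring

/-- Step 1 of the proof of Theorem 3.7 in Borodin–Olshanski:
`(𝒟₁ + ⋯ + 𝒟_N) V_N = d_N · V_N` on `ℤ^N`, where the `j`-th one-dimensional operator is
`(𝒟_j F)(x) = (x_j−u)(x_j−u')(F(x+e_j) − F(x)) + (x_j+v)(x_j+v')(F(x−e_j) − F(x))`. -/
theorem stmt8 (N : ℕ) (hN : 1 ≤ N) (u u' v v' : ℂ) (x : Fin N → ℤ) :
    (∑ j : Fin N,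
      (((x j : ℂ) - u) * ((x j : ℂ) - u') *
          (Vc (Function.update x j (x j + 1)) - Vc x) +
        ((x j : ℂ) + v) * ((x j : ℂ) + v') *
          (Vc (Function.update x j (x j - 1)) - Vc x)))
    = dConst u u' v v' N * Vc x := by
  let T : ℕ → Polynomial ℂ := fun n =>
    (.X - .C u) * (.X - .C u') * ((.X + 1) ^ n - .X ^ n) +
      (.X + .C v) * (.X + .C v') * ((.X - 1) ^ n - .X ^ n)
  have hT (n : ℕ) : (T n).natDegree ≤ n ∧
      (T n).coeff n = n * (n - 1) - (u + u' + v + v') * n :=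
    (differenceOperator_X_pow u u' v v' n).1
  set M : Matrix (Fin N) (Fin N) ℂ := Matrix.vandermonde fun i => (x i : ℂ) with hM
  let A : Matrix (Fin N) (Fin N) ℂ := .of fun k n => (T n).coeff k
  have hrow (j : Fin N) : (M * A) j =
      (((x j : ℂ) - u) * ((x j : ℂ) - u')) •
          ((fun k : Fin N => ((x j + 1 : ℤ) : ℂ) ^ (k : ℕ)) - M j) +
        (((x j : ℂ) + v) * ((x j : ℂ) + v')) •
          ((fun k : Fin N => ((x j - 1 : ℤ) : ℂ) ^ (k : ℕ)) - M j) := by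
    ext n
    have h := Polynomial.eval_eq_sum_range' ((hT n).1.trans_lt n.isLt) (x j : ℂ)
    rw [← Fin.sum_univ_eq_sum_range (fun k => (T n).coeff k * (x j : ℂ) ^ k)] at h
    simp only [Matrix.mul_apply, A, hM, Matrix.vandermonde_apply, Matrix.of_apply]
    simp_rw [mul_comm ((x j : ℂ) ^ _)]
    rw [← h]
    simp [T, Matrix.vandermonde_apply]
  have htr : A.trace = dConst u u' v v' N := by
    rw [dConst_eq_sum]
    exact Finset.sum_congr rfl fun n _ => (hT n).2
  have hsub (j : Fin N) (w : Fin N → ℂ) :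
      (M.updateRow j (w - M j)).det = (M.updateRow j w).det - M.det := by
    have h := Matrix.det_updateRow_add M j (w - M j) (M j)
    rw [sub_add_cancel, Matrix.updateRow_eq_self] at h
    rw [h, add_sub_cancel_right]
  rw [← htr, Vc_eq_mul_det_vandermonde x, mul_left_comm, ← hM, ← Matrix.sum_det_updateRow_mul,
    Finset.mul_sum]
  refine Finset.sum_congr rfl fun j _ => ?_
  rw [Vc_eq_mul_det_vandermonde, Vc_eq_mul_det_vandermonde, vandermonde_update,
    vandermonde_update, hrow, Matrix.det_updateRow_add, Matrix.det_updateRow_smul,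
    Matrix.det_updateRow_smul, hsub, hsub]
  ring
end

section
/- Let N ≥ 1 and u, u', v, v' ∈ ℂ be arbitrary. Let 𝒟^{(N)} be the matrix on GT_N built from parameters (u,u',v,v'), and let 𝒟̃^{(N+1)} be the matrix on GT_{N+1} built by the same formula with N replaced by N+1 and with parameters (u+1, u'+1, v, v') (so with constant d̃_{N+1} = (N+1)N(N−1)/3 − (u+u'+v+v'+2)·(N+1)N/2). Then for every λ ∈ GT_{N+1} and ν ∈ GT_N: Σ_{κ∈GT_{N+1}} 𝒟̃^{(N+1)}(λ,κ) Λ^{N+1}_N(κ,ν) = Σ_{ρ∈GT_N} Λ^{N+1}_N(λ,ρ) 𝒟^{(N)}(ρ,ν), both sums having only finitely many nonzero terms; in matrix notation, 𝒟̃^{(N+1)} Λ^{N+1}_N = Λ^{N+1}_N 𝒟^{(N)}. -/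
instance {N : ℕ} : DecidableEq (Sig N) := by unfold Sig; infer_instance

/-- Shifted coordinates of a signature: `l_j = λ_j + N − j` (1-based), i.e.
`lc λ i = λ_i + N − 1 − i` in 0-based indexing. -/
def lc {N : ℕ} (lam : Sig N) : Fin N → ℤ :=
  fun i => lam.1 i + (N : ℤ) - 1 - (i : ℕ)

/-- The one-dimensional bilateral birth-and-death rate matrix `𝒟` on `ℤ` with
parameters `(u,u',v,v')`. -/
def Dmat (u u' v v' : ℂ) (x y : ℤ) : ℂ :=
  if y = x + 1 then ((x : ℂ) - u) * ((x : ℂ) - u')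
  else if y = x - 1 then ((x : ℂ) + v) * ((x : ℂ) + v')
  else if y = x then -(((x : ℂ) - u) * ((x : ℂ) - u')) - ((x : ℂ) + v) * ((x : ℂ) + v')
  else 0

/-- The matrix `𝒟^{(N)}` of transition rates on `GT_N`:
`𝒟^{(N)}(λ,ν) = (V(n)/V(l)) Σ_i 𝒟(l_i,n_i)·[l_j = n_j ∀ j ≠ i] − d_N·[λ = ν]`. -/
noncomputable def DN (u u' v v' : ℂ) {N : ℕ} (lam ν : Sig N) : ℂ :=
  (Vc (lc ν) / Vc (lc lam)) *
      (∑ i : Fin N,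
        if ∀ j : Fin N, j ≠ i → lc lam j = lc ν j then
          Dmat u u' v v' (lc lam i) (lc ν i) else 0) -
    (if lam = ν then dConst u u' v v' N else 0)

/-- The step function `1[m < x]`. -/
def stepFn (x m : ℤ) : ℂ := if m < x then 1 else 0

/-- The interlacing indicator in shifted coordinates. -/
def interlaceInd {N : ℕ} (k : Fin (N + 1) → ℤ) (n : Fin N → ℤ) : ℂ :=
  if ∀ j : Fin N, k j.succ ≤ n j ∧ n j < k j.castSucc then 1 else 0

/-- The `j`-th factor of the interlacing indicator. -/
def interlaceFactor {N : ℕ} (k : Fin (N + 1) → ℤ) (n : Fin N → ℤ) (j : Fin N) : ℂ :=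
  stepFn (k j.castSucc) (n j) - stepFn (k j.succ) (n j)

theorem interlaceInd_eq_prod {N : ℕ} {k : Fin (N + 1) → ℤ} (hk : Antitone k) (n : Fin N → ℤ) :
    interlaceInd k n = ∏ j, interlaceFactor k n j := by
  have key : ∀ j, interlaceFactor k n j = if k j.succ ≤ n j ∧ n j < k j.castSucc then 1 else 0 := by
    intro j
    have h : k j.succ ≤ k j.castSucc := hk (Fin.castSucc_lt_succ).le
    unfold interlaceFactor stepFn
    split_ifs <;> first | omega | simp
  simp_rw [key, interlaceInd, Finset.prod_ite_zero]
  simp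

theorem lc_strictAnti {N : ℕ} (lam : Sig N) : StrictAnti (lc lam) := by
  intro i j hij
  have h := lam.2 i j hij.le
  have h' : (i : ℕ) < (j : ℕ) := hij
  unfold lc
  omega

theorem lc_injective {N : ℕ} : Function.Injective (lc : Sig N → Fin N → ℤ) := by
  intro a b h
  apply Subtype.ext
  funext i
  have := congrFun h i
  unfold lc at this
  omega

theorem mem_range_lc {N : ℕ} {k : Fin N → ℤ} (hk : StrictAnti k) : k ∈ Set.range (lc (N := N)) := by
  have hanti : Antitone fun i : Fin N => k i + (i : ℕ) := by
    cases N with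
    | zero => exact fun i => i.elim0
    | succ N =>
      refine Fin.antitone_iff_succ_le.2 fun i => ?_
      have := hk (Fin.castSucc_lt_succ (i := i))
      simp only [Fin.val_succ, Fin.val_castSucc]
      push_cast
      omega
  refine ⟨⟨fun i => k i + (i : ℕ) - N + 1, fun i j hij => ?_⟩, ?_⟩
  · have := hanti hij
    dsimp only at this ⊢
    omega
  · funext i
    simp only [lc]
    ring

theorem interlaceInd_eq_zero_left {N : ℕ} {k : Fin (N + 1) → ℤ} (n : Fin N → ℤ)
    (hk : k ∉ Set.range (lc (N := N + 1))) : interlaceInd k n = 0 := by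
  refine if_neg fun h => hk (mem_range_lc (Fin.strictAnti_iff_succ_lt.2 fun i => ?_))
  exact (h i).1.trans_lt (h i).2

theorem interlaceInd_eq_zero_right {N : ℕ} (l : Fin (N + 1) → ℤ) {n : Fin N → ℤ}
    (hn : n ∉ Set.range (lc (N := N))) : interlaceInd l n = 0 := by
  refine if_neg fun h => hn (mem_range_lc ?_)
  cases N with
  | zero => exact fun i => i.elim0
  | succ N =>
    refine Fin.strictAnti_iff_succ_lt.2 fun i => ?_
    exact (h i.succ).2.trans_le (h i.castSucc).1

theorem interlace_iff_lc {N : ℕ} (ν : Sig N) (lam : Sig (N + 1)) :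
    Interlace ν lam ↔ ∀ j : Fin N, lc lam j.succ ≤ lc ν j ∧ lc ν j < lc lam j.castSucc := by
  refine forall_congr' fun j => ?_
  simp only [lc, Fin.val_succ, Fin.val_castSucc]
  push_cast
  omega

theorem vprod_eq_Vc {N : ℕ} (lam : Sig N) : ((vprod lam.1 : ℤ) : ℂ) = Vc (lc lam) := by
  unfold vprod Vc
  push_cast
  refine Finset.prod_congr rfl fun i _ => Finset.prod_congr rfl fun j _ => ?_
  split_ifs
  · simp only [lc]
    push_cast
    ring
  · rfl

theorem Vc_lc_ne_zero {N : ℕ} (lam : Sig N) : Vc (lc lam) ≠ 0 := by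
  unfold Vc
  refine Finset.prod_ne_zero_iff.2 fun i _ => Finset.prod_ne_zero_iff.2 fun j _ => ?_
  split_ifs with h
  · exact sub_ne_zero.2 (by exact_mod_cast (lc_strictAnti lam h).ne')
  · exact one_ne_zero

theorem link_eq {N : ℕ} (lam : Sig (N + 1)) (ν : Sig N) :
    ((link lam ν : ℝ) : ℂ) =
      (N.factorial : ℂ) * Vc (lc ν) / Vc (lc lam) * interlaceInd (lc lam) (lc ν) := by
  unfold link interlaceInd
  simp only [← interlace_iff_lc, ← vprod_eq_Vc]
  split_ifs <;> simp

/-- If at most one factor of a product changes, the increment is given by the Leibniz rule. -/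
theorem prod_sub_prod_of_unique {ι R : Type*} [Fintype ι] [DecidableEq ι] [CommRing R]
    (f g : ι → R) (h : ∀ i j, g i ≠ f i → g j ≠ f j → i = j) :
    ∏ i, g i - ∏ i, f i = ∑ i, (g i - f i) * ∏ j ∈ Finset.univ.erase i, f j := by
  by_cases hex : ∃ i, g i ≠ f i
  · obtain ⟨i, hi⟩ := hex
    have hg : ∀ j, j ≠ i → g j = f j := fun j hj => by
      by_contra hne
      exact hj (h j i hne hi)
    rw [Finset.sum_eq_single i (fun j _ hj => by rw [hg j hj, sub_self, zero_mul]) (by simp),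
      ← Finset.mul_prod_erase _ g (Finset.mem_univ i),
      ← Finset.mul_prod_erase _ f (Finset.mem_univ i),
      Finset.prod_congr rfl fun j hj => hg j (Finset.ne_of_mem_erase hj)]
    ring
  · push Not at hex
    simp [hex]

/-- The single-coordinate transitions summed over signatures reduce to sums over `ℤ`. -/
theorem finsum_coordinate_steps {M : ℕ} (l : Fin M → ℤ) (w : Fin M → ℤ → ℂ)
    (hw : ∀ i, (Function.support (w i)).Finite) (G : (Fin M → ℤ) → ℂ)
    (hG : ∀ k ∉ Set.range (lc (N := M)), G k = 0) :
    (Function.support fun κ : Sig M =>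
      (∑ i, if ∀ j, j ≠ i → l j = lc κ j then w i (lc κ i) else 0) * G (lc κ)).Finite ∧
    ∑ᶠ κ : Sig M, (∑ i, if ∀ j, j ≠ i → l j = lc κ j then w i (lc κ i) else 0) * G (lc κ) =
      ∑ i, ∑ᶠ y, w i y * G (Function.update l i y) := by
  set F : Fin M → (Fin M → ℤ) → ℂ :=
    fun i k => (if ∀ j, j ≠ i → l j = k j then w i (k i) else 0) * G k with hF
  have hupd : ∀ i k, (∀ j, j ≠ i → l j = k j) → Function.update l i (k i) = k := by
    intro i k h
    funext j
    by_cases hj : j = i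
    · subst hj; simp
    · simp [hj, h j hj]
  have hsub : ∀ i, Function.support (F i) ⊆ Function.update l i '' Function.support (w i) := by
    intro i k hk
    have h1 := left_ne_zero_of_mul hk
    by_cases h : ∀ j, j ≠ i → l j = k j
    · rw [if_pos h] at h1
      exact ⟨k i, h1, hupd i k h⟩
    · rw [if_neg h] at h1
      exact absurd rfl h1
  have hfin : ∀ i, (Function.support (F i)).Finite := fun i => ((hw i).image _).subset (hsub i)
  have hsum : (fun κ : Sig M =>
      (∑ i, if ∀ j, j ≠ i → l j = lc κ j then w i (lc κ i) else 0) * G (lc κ)) =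
      fun κ => ∑ i, F i (lc κ) := by
    funext κ
    rw [Finset.sum_mul]
  have hfin' : (Function.support fun k => ∑ i, F i k).Finite :=
    (Set.finite_iUnion hfin).subset fun k hk => by
      obtain ⟨i, -, hi⟩ := Finset.exists_ne_zero_of_sum_ne_zero hk
      exact Set.mem_iUnion.2 ⟨i, hi⟩
  rw [hsum]
  refine ⟨hfin'.preimage lc_injective.injOn, ?_⟩
  rw [← finsum_mem_range (f := fun k => ∑ i, F i k) lc_injective, finsum_mem_def,
    Set.indicator_eq_self.2, finsum_sum_comm _ _ fun i _ => hfin i]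
  · refine Finset.sum_congr rfl fun i _ => ?_
    have hinj : Function.Injective (Function.update l i) := Function.update_injective l i
    change ∑ᶠ k, F i k = _
    rw [← Set.indicator_eq_self.2 ((hsub i).trans (Set.image_subset_range _ _)),
      ← finsum_mem_def, finsum_mem_range hinj]
    refine finsum_congr fun y => ?_
    simp only [hF]
    rw [if_pos fun j hj => by simp [hj]]
    simp
  · intro k hk
    by_contra hr
    exact hk (by simp [hF, hG k hr])

theorem Dmat_finsum_right (u u' v v' : ℂ) (x : ℤ) (g : ℤ → ℂ) :
    (Function.support (Dmat u u' v v' x)).Finite ∧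
    ∑ᶠ y, Dmat u u' v v' x y * g y =
      (x - u) * (x - u') * (g (x + 1) - g x) + (x + v) * (x + v') * (g (x - 1) - g x) := by
  have hs : Function.support (Dmat u u' v v' x) ⊆ ({x + 1, x - 1, x} : Finset ℤ) := by
    intro y hy
    by_contra h
    simp only [Finset.coe_insert, Finset.coe_singleton, Set.mem_insert_iff,
      Set.mem_singleton_iff, not_or] at h
    exact hy (by simp [Dmat, h])
  refine ⟨(Finset.finite_toSet _).subset hs, ?_⟩
  rw [finsum_eq_sum_of_support_subset (s := {x + 1, x - 1, x}) _
    ((Function.support_mul_subset_left _ _).trans hs),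
    Finset.sum_insert (by simp; omega), Finset.sum_insert (by simp), Finset.sum_singleton]
  have h1 : ¬ x - 1 = x + 1 := by omega
  have h2 : ¬ x = x - 1 := by omega
  simp only [Dmat, h1, h2, left_eq_add, one_ne_zero, if_true, if_false]
  ring

theorem Dmat_finsum_left (u u' v v' : ℂ) (m : ℤ) (g : ℤ → ℂ) :
    (Function.support fun y => Dmat u u' v v' y m).Finite ∧
    ∑ᶠ y, Dmat u u' v v' y m * g y =
      (m - 1 - u) * (m - 1 - u') * g (m - 1) + (m + 1 + v) * (m + 1 + v') * g (m + 1) -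
        ((m - u) * (m - u') + (m + v) * (m + v')) * g m := by
  have hs : (Function.support fun y => Dmat u u' v v' y m) ⊆ ({m - 1, m + 1, m} : Finset ℤ) := by
    intro y hy
    by_contra h
    simp only [Finset.coe_insert, Finset.coe_singleton, Set.mem_insert_iff,
      Set.mem_singleton_iff, not_or] at h
    refine hy ?_
    simp only [Dmat]
    rw [if_neg (by omega), if_neg (by omega), if_neg (by omega)]
  refine ⟨(Finset.finite_toSet _).subset hs, ?_⟩
  rw [finsum_eq_sum_of_support_subset (s := {m - 1, m + 1, m}) _
    ((Function.support_mul_subset_left _ _).trans hs),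
    Finset.sum_insert (by simp; omega), Finset.sum_insert (by simp), Finset.sum_singleton]
  have h1 : ¬ m = m + 1 + 1 := by omega
  have h2 : ¬ m = m - 1 := by omega
  simp only [Dmat, h1, h2, sub_add_cancel, add_sub_cancel_right, left_eq_add, one_ne_zero,
    if_true, if_false]
  push_cast
  ring

/-- The one-dimensional commutation relation between `𝒟` and the step function. -/
theorem step_commutation (u u' v v' : ℂ) (x m : ℤ) :
    (x - (u + 1)) * (x - (u' + 1)) * (stepFn (x + 1) m - stepFn x m) +
        (x + v) * (x + v') * (stepFn (x - 1) m - stepFn x m) =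
      (m - 1 - u) * (m - 1 - u') * stepFn x (m - 1) +
        (m + 1 + v) * (m + 1 + v') * stepFn x (m + 1) -
        ((m - u) * (m - u') + (m + v) * (m + v')) * stepFn x m -
        (u + u' + v + v' + 2) * stepFn x m := by
  obtain h | rfl | rfl | h : x < m ∨ x = m ∨ x = m + 1 ∨ m + 1 < x := by omega
  · simp [stepFn, show ¬ m < x + 1 by omega, show ¬ m < x by omega, show ¬ m < x - 1 by omega,
      show ¬ m - 1 < x by omega, show ¬ m + 1 < x by omega]
  · simp [stepFn, show ¬ x < x - 1 by omega]
    ring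
  · simp [stepFn, show m < m + 1 + 1 by omega, show m - 1 < m + 1 by omega]
    ring
  · simp [stepFn, show m < x + 1 by omega, show m < x by omega, show m < x - 1 by omega,
      show m - 1 < x by omega, show m + 1 < x by omega]
    ring

theorem antitone_update_step {M : ℕ} {l : Fin M → ℤ} (hl : StrictAnti l) (i : Fin M) {y : ℤ}
    (h1 : l i - 1 ≤ y) (h2 : y ≤ l i + 1) : Antitone (Function.update l i y) := by
  intro p q hpq
  rcases hpq.eq_or_lt with rfl | hlt
  · exact le_rfl
  have h := hl hlt
  by_cases hp : p = i
  · subst hp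
    rw [Function.update_self, Function.update_of_ne hlt.ne']
    omega
  · by_cases hq : q = i
    · subst hq
      rw [Function.update_self, Function.update_of_ne hp]
      omega
    · rw [Function.update_of_ne hp, Function.update_of_ne hq]
      exact h.le

/-- Moving one upper coordinate across at most one of the distinct thresholds `n j` changes the
interlacing indicator by the Leibniz rule. -/
theorem interlaceInd_update_sub {N : ℕ} {l : Fin (N + 1) → ℤ} {n : Fin N → ℤ}
    (hl : StrictAnti l) (hn : Function.Injective n) (i : Fin (N + 1)) {y : ℤ}
    (hy : y = l i + 1 ∨ y = l i - 1) :
    interlaceInd (Function.update l i y) n - interlaceInd l n =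
      ∑ j, (interlaceFactor (Function.update l i y) n j - interlaceFactor l n j) *
        ∏ j' ∈ Finset.univ.erase j, interlaceFactor l n j' := by
  rw [interlaceInd_eq_prod (antitone_update_step hl i (by omega) (by omega)),
    interlaceInd_eq_prod hl.antitone]
  refine prod_sub_prod_of_unique _ _ ?_
  have hstep : ∀ p m, stepFn (Function.update l i y p) m ≠ stepFn (l p) m →
      m = min y (l i) := by
    intro p m h
    by_cases hp : p = i
    · subst hp
      rw [Function.update_self] at h
      unfold stepFn at h
      split_ifs at h <;> first | omega | exact absurd rfl h
    · exact absurd (by rw [Function.update_of_ne hp]) h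
  have hfac : ∀ j, interlaceFactor (Function.update l i y) n j ≠ interlaceFactor l n j →
      n j = min y (l i) := by
    intro j h
    by_contra hne
    refine h ?_
    unfold interlaceFactor
    rw [not_imp_comm.1 (hstep _ _) hne, not_imp_comm.1 (hstep _ _) hne]
  exact fun p q hp hq => hn ((hfac p hp).trans (hfac q hq).symm)

theorem sum_interlaceFactor_update {N : ℕ} (l : Fin (N + 1) → ℤ) (n : Fin N → ℤ) (j : Fin N)
    (c : Fin (N + 1) → ℂ) (y : Fin (N + 1) → ℤ) :
    ∑ i, c i * (interlaceFactor (Function.update l i (y i)) n j - interlaceFactor l n j) =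
      c j.castSucc * (stepFn (y j.castSucc) (n j) - stepFn (l j.castSucc) (n j)) -
        c j.succ * (stepFn (y j.succ) (n j) - stepFn (l j.succ) (n j)) := by
  have hone : ∀ p, ∑ i, c i * (stepFn (Function.update l i (y i) p) (n j) - stepFn (l p) (n j)) =
      c p * (stepFn (y p) (n j) - stepFn (l p) (n j)) := by
    intro p
    rw [Finset.sum_eq_single p (fun i _ hi => by simp [Function.update_of_ne hi.symm]) (by simp),
      Function.update_self]
  rw [← hone, ← hone, ← Finset.sum_sub_distrib]
  refine Finset.sum_congr rfl fun i _ => ?_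
  unfold interlaceFactor
  ring

theorem interlaceInd_update_right {N : ℕ} {l : Fin (N + 1) → ℤ} (hl : Antitone l)
    (n : Fin N → ℤ) (j : Fin N) (y : ℤ) :
    interlaceInd l (Function.update n j y) =
      (stepFn (l j.castSucc) y - stepFn (l j.succ) y) *
        ∏ j' ∈ Finset.univ.erase j, interlaceFactor l n j' := by
  rw [interlaceInd_eq_prod hl, ← Finset.mul_prod_erase _ _ (Finset.mem_univ j)]
  congr 1
  · simp [interlaceFactor]
  · refine Finset.prod_congr rfl fun p hp => ?_
    simp [interlaceFactor, Function.update_of_ne (Finset.ne_of_mem_erase hp)]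

/-- Commutation of the coordinatewise generators with the interlacing indicator. -/
theorem interlaceInd_commutation {N : ℕ} (u u' v v' : ℂ) {l : Fin (N + 1) → ℤ} {n : Fin N → ℤ}
    (hl : StrictAnti l) (hn : Function.Injective n) :
    ∑ i, ∑ᶠ y, Dmat (u + 1) (u' + 1) v v' (l i) y * interlaceInd (Function.update l i y) n =
      ∑ j, ∑ᶠ y, Dmat u u' v v' y (n j) * interlaceInd l (Function.update n j y) -
        N * (u + u' + v + v' + 2) * interlaceInd l n := by
  simp_rw [fun i => (Dmat_finsum_right (u + 1) (u' + 1) v v' (l i)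
    fun y => interlaceInd (Function.update l i y) n).2,
    fun j => (Dmat_finsum_left u u' v v' (n j) fun y => interlaceInd l (Function.update n j y)).2,
    Function.update_eq_self]
  have hconst : (N : ℂ) * (u + u' + v + v' + 2) * interlaceInd l n =
      ∑ j : Fin N, (u + u' + v + v' + 2) * interlaceInd l n := by
    simp [mul_assoc]
  have hself : ∀ j, interlaceInd l n = (stepFn (l j.castSucc) (n j) - stepFn (l j.succ) (n j)) *
      ∏ j' ∈ Finset.univ.erase j, interlaceFactor l n j' := fun j => by
    rw [← interlaceInd_update_right hl.antitone, Function.update_eq_self]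
  simp_rw [fun i => interlaceInd_update_sub hl hn i (Or.inl rfl),
    fun i => interlaceInd_update_sub hl hn i (Or.inr rfl)]
  rw [hconst, ← Finset.sum_sub_distrib]
  simp_rw [Finset.mul_sum, ← Finset.sum_add_distrib]
  rw [Finset.sum_comm]
  refine Finset.sum_congr rfl fun j _ => ?_
  simp_rw [← mul_assoc]
  rw [Finset.sum_add_distrib, ← Finset.sum_mul, ← Finset.sum_mul,
    sum_interlaceFactor_update l n j
      (fun i => ((l i : ℂ) - (u + 1)) * ((l i : ℂ) - (u' + 1))) fun i => l i + 1,
    sum_interlaceFactor_update l n j (fun i => ((l i : ℂ) + v) * ((l i : ℂ) + v')) fun i => l i - 1,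
    hself j, interlaceInd_update_right hl.antitone, interlaceInd_update_right hl.antitone]
  linear_combination (∏ j' ∈ Finset.univ.erase j, interlaceFactor l n j') *
    (step_commutation u u' v v' (l j.castSucc) (n j) -
      step_commutation u u' v v' (l j.succ) (n j))

theorem finsum_DN_mul_link {N : ℕ} (u u' v v' : ℂ) (lam : Sig (N + 1)) (ν : Sig N) :
    ∑ᶠ κ : Sig (N + 1), DN u u' v v' lam κ * ((link κ ν : ℝ) : ℂ) =
      (N.factorial : ℂ) * Vc (lc ν) / Vc (lc lam) *
        (∑ i, ∑ᶠ y, Dmat u u' v v' (lc lam i) y *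
          interlaceInd (Function.update (lc lam) i y) (lc ν) -
          dConst u u' v v' (N + 1) * interlaceInd (lc lam) (lc ν)) := by
  obtain ⟨hfin, hsum⟩ := finsum_coordinate_steps (lc lam)
    (fun i y => Dmat u u' v v' (lc lam i) y)
    (fun i => (Dmat_finsum_right u u' v v' (lc lam i) 0).1) (fun k => interlaceInd k (lc ν))
    fun k hk => interlaceInd_eq_zero_left _ hk
  have hdiag : ∑ᶠ κ, (if lam = κ then
      dConst u u' v v' (N + 1) * interlaceInd (lc κ) (lc ν) else 0) =
      dConst u u' v v' (N + 1) * interlaceInd (lc lam) (lc ν) := by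
    rw [finsum_eq_single _ lam fun κ hκ => if_neg hκ.symm, if_pos rfl]
  rw [← hsum, ← hdiag, ← finsum_sub_distrib hfin, ← smul_eq_mul, smul_finsum]
  · refine finsum_congr fun κ => ?_
    rw [link_eq, DN, smul_eq_mul]
    have h1 := Vc_lc_ne_zero lam
    have h2 := Vc_lc_ne_zero κ
    split_ifs with h
    · subst h
      field_simp
    · field_simp
      ring
  · refine (Set.finite_singleton lam).subset fun κ hκ => ?_
    by_contra hne
    exact hκ (if_neg fun h => hne h.symm)

theorem finsum_link_mul_DN {N : ℕ} (u u' v v' : ℂ) (lam : Sig (N + 1)) (ν : Sig N) :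
    ∑ᶠ ρ : Sig N, ((link lam ρ : ℝ) : ℂ) * DN u u' v v' ρ ν =
      (N.factorial : ℂ) * Vc (lc ν) / Vc (lc lam) *
        (∑ j, ∑ᶠ y, Dmat u u' v v' y (lc ν j) *
          interlaceInd (lc lam) (Function.update (lc ν) j y) -
          dConst u u' v v' N * interlaceInd (lc lam) (lc ν)) := by
  obtain ⟨hfin, hsum⟩ := finsum_coordinate_steps (lc ν)
    (fun j y => Dmat u u' v v' y (lc ν j))
    (fun j => (Dmat_finsum_left u u' v v' (lc ν j) 0).1) (fun r => interlaceInd (lc lam) r)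
    fun k hk => interlaceInd_eq_zero_right _ hk
  have hdiag : ∑ᶠ ρ, (if ρ = ν then
      dConst u u' v v' N * interlaceInd (lc lam) (lc ρ) else 0) =
      dConst u u' v v' N * interlaceInd (lc lam) (lc ν) := by
    rw [finsum_eq_single _ ν fun ρ hρ => if_neg hρ, if_pos rfl]
  rw [← hsum, ← hdiag, ← finsum_sub_distrib hfin, ← smul_eq_mul, smul_finsum]
  · refine finsum_congr fun ρ => ?_
    rw [link_eq, DN, smul_eq_mul]
    have h1 := Vc_lc_ne_zero lam
    have h2 := Vc_lc_ne_zero ρ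
    simp_rw [eq_comm (a := lc ρ _)]
    split_ifs with h
    · subst h
      field_simp
    · field_simp
      ring
  · refine (Set.finite_singleton ν).subset fun ρ hρ => ?_
    by_contra hne
    exact hρ (if_neg hne)

/-- Proposition 4.2 of Borodin–Olshanski (infinitesimal commutativity):
`𝒟̃^{(N+1)} Λ^{N+1}_N = Λ^{N+1}_N 𝒟^{(N)}`, where `𝒟̃^{(N+1)}` is built on `GT_{N+1}`
with parameters `(u+1, u'+1, v, v')`. -/
theorem stmt10 (N : ℕ) (hN : 1 ≤ N) (u u' v v' : ℂ) (lam : Sig (N + 1)) (ν : Sig N) :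
    (∑ᶠ κ : Sig (N + 1), DN (u + 1) (u' + 1) v v' lam κ * ((link κ ν : ℝ) : ℂ))
      = ∑ᶠ ρ : Sig N, ((link lam ρ : ℝ) : ℂ) * DN u u' v v' ρ ν := by
  rw [finsum_DN_mul_link, finsum_link_mul_DN,
    interlaceInd_commutation u u' v v' (lc_strictAnti lam) (lc_strictAnti ν).injective]
  congr 1
  unfold dConst
  push_cast
  ring
end
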